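/- arXiv:1112.4577 — 9 statements merged into one kernel-verified Lean document; each statement's English description precedes it below -/
import Mathlib

section
/- Let R be a unital associative algebra over a field K of characteristic zero and let x, y, z ∈ R. Then the three relations xy + yx = 2z, yz + zy = 2x, zx + xz = 2y hold if and only if 2z = xy + yx and the two relations x²y + 2xyx + yx² = 4y and y²x + 2yxy + xy² = 4x hold. (Consequently the algebra defined by generators x, y, z and the three relations has an alternate presentation by generators x, y and the two relations.) -/
/-- In an algebra over a field of characteristic zero, multiplication by `2` is injective. -/
theorem two_mul_cancel_of_algebra (K : Type*) {R : Type*} [Field K] [CharZero K] [Ring R]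
    [Algebra K R] {a b : R} (h : 2 * a = 2 * b) : a = b := by
  have h2 : (2 : K) • a = (2 : K) • b := by
    simpa only [two_smul, two_mul] using h
  exact (IsUnit.mk0 (2 : K) two_ne_zero).smul_left_cancel.mp h2

/-- If `2c = ab + ba`, then the anticommutator of `a` with `ab + ba` is twice that with `c`. -/
theorem anticommutator_expand {R : Type*} [Ring R] {a b c : R} (h : 2 * c = a * b + b * a) :
    a ^ 2 * b + 2 * (a * b * a) + b * a ^ 2 = 2 * (c * a + a * c) := by
  calc a ^ 2 * b + 2 * (a * b * a) + b * a ^ 2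
      = (a * b + b * a) * a + a * (a * b + b * a) := by noncomm_ring
    _ = 2 * (c * a + a * c) := by rw [← h]; noncomm_ring

/-- Let `R` be a unital associative algebra over a field `K` of
characteristic zero and let `x, y, z ∈ R`.  Then the three relations
`xy + yx = 2z`, `yz + zy = 2x`, `zx + xz = 2y` hold if and only if `2z = xy + yx`
and the two relations `x²y + 2xyx + yx² = 4y`, `y²x + 2yxy + xy² = 4x` hold. -/
theorem stmt0 {K R : Type*} [Field K] [CharZero K] [Ring R] [Algebra K R]
    (x y z : R) :
    (x * y + y * x = 2 * z ∧ y * z + z * y = 2 * x ∧ z * x + x * z = 2 * y) ↔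
    (2 * z = x * y + y * x ∧
      x ^ 2 * y + 2 * (x * y * x) + y * x ^ 2 = 4 * y ∧
      y ^ 2 * x + 2 * (y * x * y) + x * y ^ 2 = 4 * x) := by
  have four (a : R) : 4 * a = 2 * (2 * a) := by noncomm_ring
  constructor
  · rintro ⟨hz, hx, hy⟩
    refine ⟨hz.symm, ?_, ?_⟩
    · rw [anticommutator_expand hz.symm, hy, four]
    · rw [anticommutator_expand (hz.symm.trans (add_comm _ _)), add_comm (z * y), hx, four]
  · rintro ⟨hz, hy, hx⟩
    rw [anticommutator_expand hz, four] at hy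
    rw [anticommutator_expand (hz.trans (add_comm _ _)), add_comm (z * y), four] at hx
    exact ⟨hz.symm, two_mul_cancel_of_algebra K hx, two_mul_cancel_of_algebra K hy⟩
end

section
/- In the algebra 𝒜, the elements 1, x, y, z are linearly independent over K; that is, if a, b, c, e ∈ K satisfy ax + by + cz + e·1 = 0 in 𝒜, then a = b = c = e = 0. -/
/-- The defining relations of the algebra `𝒜`: it is the quotient of the free
`K`-algebra on three generators `X, Y, Z` (indexed by `0, 1, 2 : Fin 3`) by the
two-sided ideal generated by `XY + YX − 2Z`, `YZ + ZY − 2X`, `ZX + XZ − 2Y`. -/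
inductive ARel (K : Type*) [Field K] :
    FreeAlgebra K (Fin 3) → FreeAlgebra K (Fin 3) → Prop
  | rel1 : ARel K
      (FreeAlgebra.ι K (0 : Fin 3) * FreeAlgebra.ι K 1 +
        FreeAlgebra.ι K 1 * FreeAlgebra.ι K 0)
      (2 * FreeAlgebra.ι K 2)
  | rel2 : ARel K
      (FreeAlgebra.ι K (1 : Fin 3) * FreeAlgebra.ι K 2 +
        FreeAlgebra.ι K 2 * FreeAlgebra.ι K 1)
      (2 * FreeAlgebra.ι K 0)
  | rel3 : ARel K
      (FreeAlgebra.ι K (2 : Fin 3) * FreeAlgebra.ι K 0 +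
        FreeAlgebra.ι K 0 * FreeAlgebra.ι K 2)
      (2 * FreeAlgebra.ι K 1)

/-- A solution of `p q = r`, `q r = p`, `r p = q` in `K` defines a character of `𝒜`, so any linear
relation between `x, y, z, 1` in `𝒜` also holds between `p, q, r, 1`. -/
theorem ARel.linear_relation_eval {K : Type*} [Field K] {a b c e : K}
    (h : a • RingQuot.mkAlgHom K (ARel K) (FreeAlgebra.ι K 0)
        + b • RingQuot.mkAlgHom K (ARel K) (FreeAlgebra.ι K 1)
        + c • RingQuot.mkAlgHom K (ARel K) (FreeAlgebra.ι K 2)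
        + e • (1 : RingQuot (ARel K)) = 0)
    (p q r : K) (hr : p * q = r) (hp : q * r = p) (hq : r * p = q) :
    a * p + b * q + c * r + e = 0 := by
  have hrel : ∀ ⦃u v⦄, ARel K u v →
      FreeAlgebra.lift K ![p, q, r] u = FreeAlgebra.lift K ![p, q, r] v := by
    rintro _ _ (_ | _ | _) <;>
      simp only [two_mul, map_add, map_mul, FreeAlgebra.lift_ι_apply] <;> simp
    · linear_combination 2 * hr
    · linear_combination 2 * hp
    · linear_combination 2 * hq
  simpa using congrArg (RingQuot.liftAlgHom K ⟨FreeAlgebra.lift K ![p, q, r], hrel⟩) h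

/-- In the algebra `𝒜`, the elements `1, x, y, z` are linearly
independent over `K`: if `a x + b y + c z + e 1 = 0` then `a = b = c = e = 0`. -/
theorem stmt1 (K : Type*) [Field K] [IsAlgClosed K] [CharZero K] (a b c e : K)
    (h : a • RingQuot.mkAlgHom K (ARel K) (FreeAlgebra.ι K 0)
        + b • RingQuot.mkAlgHom K (ARel K) (FreeAlgebra.ι K 1)
        + c • RingQuot.mkAlgHom K (ARel K) (FreeAlgebra.ι K 2)
        + e • (1 : RingQuot (ARel K)) = 0) :
    a = 0 ∧ b = 0 ∧ c = 0 ∧ e = 0 := by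
  have h₀ := ARel.linear_relation_eval h 0 0 0 (by simp) (by simp) (by simp)
  have h₁ := ARel.linear_relation_eval h 1 1 1 (by simp) (by simp) (by simp)
  have h₂ := ARel.linear_relation_eval h 1 (-1) (-1) (by simp) (by simp) (by simp)
  have h₃ := ARel.linear_relation_eval h (-1) 1 (-1) (by simp) (by simp) (by simp)
  have h₄ := ARel.linear_relation_eval h (-1) (-1) 1 (by simp) (by simp) (by simp)
  refine ⟨?_, ?_, ?_, ?_⟩
  · linear_combination (h₁ + h₂) / 2 - h₀
  · linear_combination (h₁ + h₃) / 2 - h₀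
  · linear_combination (h₁ + h₄) / 2 - h₀
  · linear_combination h₀
end

section
/- Let V be a K-vector space and let X, Y, Z : V → V be linear maps satisfying the 𝒜-relations. Then for every λ ∈ K and every v ∈ V with X(v) = λv, one has X((Y+Z)(v)) = (2−λ)·(Y+Z)(v) and X((Y−Z)(v)) = (−2−λ)·(Y−Z)(v). Consequently Y(v) and Z(v) lie in the sum of the eigenspace of X for 2−λ and the eigenspace of X for −2−λ. -/
/-- Linear maps `X, Y, Z` on a `K`-vector space satisfy the 𝒜-relations whenever
`X∘Y + Y∘X = 2Z`, `Y∘Z + Z∘Y = 2X`, `Z∘X + X∘Z = 2Y`. -/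
def ARels {K V : Type*} [Field K] [AddCommGroup V] [Module K V]
    (X Y Z : V →ₗ[K] V) : Prop :=
  X ∘ₗ Y + Y ∘ₗ X = (2 : K) • Z ∧
  Y ∘ₗ Z + Z ∘ₗ Y = (2 : K) • X ∧
  Z ∘ₗ X + X ∘ₗ Z = (2 : K) • Y

/-- The eigenspace of a linear map `f` for the scalar `μ`:
`{v ∈ V : f(v) = μ v}`. -/
def eigSp {K V : Type*} [Field K] [AddCommGroup V] [Module K V]
    (f : V →ₗ[K] V) (μ : K) : Submodule K V :=
  LinearMap.ker (f - μ • LinearMap.id)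

/-- Membership in `eigSp` is the eigenvector equation. -/
theorem mem_eigSp_iff {K V : Type*} [Field K] [AddCommGroup V] [Module K V]
    {f : V →ₗ[K] V} {μ : K} {v : V} : v ∈ eigSp f μ ↔ f v = μ • v := by
  simp [eigSp, sub_eq_zero]

/-- Let `X, Y, Z` be linear maps on a `K`-vector space `V`
satisfying the 𝒜-relations.  Then for every `λ ∈ K` and every `v ∈ V` with
`X(v) = λ v`, one has `X((Y+Z)(v)) = (2−λ)(Y+Z)(v)` and
`X((Y−Z)(v)) = (−2−λ)(Y−Z)(v)`; consequently `Y(v)` and `Z(v)` lie in the sum of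
the eigenspace of `X` for `2−λ` and the eigenspace of `X` for `−2−λ`. -/
theorem stmt2 {K V : Type*} [Field K] [CharZero K] [AddCommGroup V] [Module K V]
    (X Y Z : V →ₗ[K] V) (hrel : ARels X Y Z) (lam : K) (v : V)
    (hv : X v = lam • v) :
    X ((Y + Z) v) = (2 - lam) • ((Y + Z) v) ∧
    X ((Y - Z) v) = (-2 - lam) • ((Y - Z) v) ∧
    Y v ∈ eigSp X (2 - lam) ⊔ eigSp X (-2 - lam) ∧
    Z v ∈ eigSp X (2 - lam) ⊔ eigSp X (-2 - lam) := by
  obtain ⟨hXY, -, hZX⟩ := hrel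
  have hY : X (Y v) = (2 : K) • Z v - lam • Y v := by
    have h := LinearMap.congr_fun hXY v
    simp only [LinearMap.add_apply, LinearMap.comp_apply, LinearMap.smul_apply, hv, map_smul] at h
    exact eq_sub_of_add_eq h
  have hZ : X (Z v) = (2 : K) • Y v - lam • Z v := by
    have h := LinearMap.congr_fun hZX v
    simp only [LinearMap.add_apply, LinearMap.comp_apply, LinearMap.smul_apply, hv, map_smul] at h
    exact eq_sub_of_add_eq' h
  have hadd : X ((Y + Z) v) = (2 - lam) • ((Y + Z) v) := by
    rw [LinearMap.add_apply, map_add, hY, hZ]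
    module
  have hsub : X ((Y - Z) v) = (-2 - lam) • ((Y - Z) v) := by
    rw [LinearMap.sub_apply, map_sub, hY, hZ]
    module
  have hmem_add := mem_eigSp_iff.2 hadd
  have hmem_sub := mem_eigSp_iff.2 hsub
  refine ⟨hadd, hsub, ?_, ?_⟩
  · have h : Y v = (2⁻¹ : K) • (Y + Z) v + (2⁻¹ : K) • (Y - Z) v := by
      simp only [LinearMap.add_apply, LinearMap.sub_apply]
      module
    rw [h]
    exact Submodule.add_mem_sup (Submodule.smul_mem _ _ hmem_add) (Submodule.smul_mem _ _ hmem_sub)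
  · have h : Z v = (2⁻¹ : K) • (Y + Z) v + (-2⁻¹ : K) • (Y - Z) v := by
      simp only [LinearMap.add_apply, LinearMap.sub_apply]
      module
    rw [h]
    exact Submodule.add_mem_sup (Submodule.smul_mem _ _ hmem_add) (Submodule.smul_mem _ _ hmem_sub)
end

section
/- Let K be a field of characteristic zero and let L be a finite connected subset of K with cardinality d + 1. Then there is an enumeration θ_0, θ_1, …, θ_d of the elements of L (a bijection from {0,…,d} onto L) such that θ_i and θ_{i+1} are adjacent for 0 ≤ i ≤ d−1. -/
/-- Two distinct elements `λ, μ` of `K` are adjacent whenever `λ + μ = 2` or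
`λ + μ = −2`. -/
def Adjacent {K : Type*} [Field K] (lam mu : K) : Prop :=
  lam ≠ mu ∧ (lam + mu = 2 ∨ lam + mu = -2)

/-- A subset `L ⊆ K` is connected whenever it is nonempty and for every
partition of `L` into two nonempty subsets `M₁`, `M₂` there exist `μ ∈ M₁` and
`σ ∈ M₂` that are adjacent. -/
def ConnectedSet {K : Type*} [Field K] (L : Set K) : Prop :=
  L.Nonempty ∧
  ∀ M₁ M₂ : Set K, M₁ ∪ M₂ = L → Disjoint M₁ M₂ → M₁.Nonempty → M₂.Nonempty →
    ∃ mu ∈ M₁, ∃ sig ∈ M₂, Adjacent mu sig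

theorem Adjacent.symm {K : Type*} [Field K] {a b : K} (h : Adjacent a b) : Adjacent b a :=
  ⟨h.1.symm, by simpa only [add_comm b a] using h.2⟩

/-- An element has at most two neighbours. -/
theorem Adjacent.eq_or_eq_of_ne {K : Type*} [Field K] {m a b c : K} (ha : Adjacent m a)
    (hb : Adjacent m b) (hc : Adjacent m c) (hab : a ≠ b) : c = a ∨ c = b := by
  obtain ⟨-, ha⟩ := ha
  obtain ⟨-, hb⟩ := hb
  obtain ⟨-, hc⟩ := hc
  grind

/-- A path which contains `m` but not its neighbour `s` can be extended by `s` at one end. -/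
theorem List.IsChain.cons_or_concat_of_adjacent {K : Type*} [Field K] {l : List K} {m s : K}
    (hl : l.IsChain Adjacent) (hnd : l.Nodup) (hm : m ∈ l) (hs : s ∉ l) (hms : Adjacent m s) :
    (s :: l).IsChain Adjacent ∨ (l ++ [s]).IsChain Adjacent := by
  obtain ⟨u, v, rfl⟩ := List.append_of_mem hm
  rcases List.eq_nil_or_concat u with rfl | ⟨u, a, rfl⟩
  · exact .inl (List.isChain_cons_cons.2 ⟨hms.symm, hl⟩)
  rcases v with _ | ⟨b, v⟩
  · refine .inr (List.isChain_append.2 ⟨hl, List.isChain_singleton _, ?_⟩)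
    simpa using hms
  · exfalso
    have ham : Adjacent a m := by
      have := (List.isChain_append.1 hl).2.2
      simpa using this
    have hmb : Adjacent m b :=
      (List.isChain_cons_cons.1 (List.isChain_append.1 hl).2.1).1
    have hab : a ≠ b := by
      rintro rfl
      simp [List.nodup_append] at hnd
    rcases ham.symm.eq_or_eq_of_ne hmb hms hab with rfl | rfl <;> simp at hs

theorem List.Nodup.ncard_setOf_mem {α : Type*} {l : List α} (hl : l.Nodup) :
    {x | x ∈ l}.ncard = l.length := by
  classical
  rw [← List.coe_toFinset, Set.ncard_coe_finset, List.toFinset_card_of_nodup hl]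

/-- A connected set contains paths on any positive number of vertices up to its cardinality. -/
theorem ConnectedSet.exists_isChain {K : Type*} [Field K] {L : Set K} (hL : ConnectedSet L)
    (n : ℕ) (hn : n < L.ncard) :
    ∃ l : List K, l.length = n + 1 ∧ l.Nodup ∧ l.IsChain Adjacent ∧ ∀ x ∈ l, x ∈ L := by
  induction n with
  | zero =>
    obtain ⟨x, hx⟩ := hL.1
    exact ⟨[x], by simpa using hx⟩
  | succ n ih =>
    obtain ⟨l, hlen, hnd, hch, hsub⟩ := ih (by omega)
    have hne : {x | x ∈ l}.Nonempty := by
      cases l with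
      | nil => simp at hlen
      | cons a l => exact ⟨a, by simp⟩
    have hdiff : (L \ {x | x ∈ l}).Nonempty := by
      apply Set.sdiff_nonempty_of_ncard_lt_ncard _ l.finite_toSet
      rw [hnd.ncard_setOf_mem]
      omega
    obtain ⟨m, hm, s, ⟨hsL, hsl⟩, hms⟩ :=
      hL.2 _ _ (Set.union_sdiff_cancel hsub) Set.disjoint_sdiff_right hne hdiff
    have hm : m ∈ l := hm
    have hsl : s ∉ l := hsl
    rcases hch.cons_or_concat_of_adjacent hnd hm hsl hms with h | h
    · exact ⟨s :: l, by simp [hlen], List.nodup_cons.2 ⟨hsl, hnd⟩, h, by simpa [hsL] using hsub⟩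
    · refine ⟨l ++ [s], by simp [hlen], List.nodup_append.2 ⟨hnd, by simp, ?_⟩, h, ?_⟩
      · rintro a ha b hb rfl
        exact hsl (List.mem_singleton.1 hb ▸ ha)
      · intro x hx
        rcases List.mem_append.1 hx with hx | hx
        · exact hsub x hx
        · exact List.mem_singleton.1 hx ▸ hsL

/-- Let `L` be a finite connected subset of `K` with
cardinality `d + 1`.  Then there is an enumeration `θ_0, …, θ_d` of the elements
of `L` such that `θ_i` and `θ_{i+1}` are adjacent for `0 ≤ i ≤ d − 1`. -/
theorem stmt4 {K : Type*} [Field K] [CharZero K] (L : Set K) (d : ℕ)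
    (hfin : L.Finite) (hconn : ConnectedSet L) (hcard : L.ncard = d + 1) :
    ∃ θ : Fin (d + 1) → K,
      Function.Injective θ ∧ Set.range θ = L ∧
      ∀ i : ℕ, ∀ h : i < d,
        Adjacent (θ ⟨i, by omega⟩) (θ ⟨i + 1, by omega⟩) := by
  obtain ⟨l, hlen, hnd, hch, hsub⟩ := hconn.exists_isChain d (by omega)
  have hl : {x | x ∈ l} = L := by
    have hle : L.ncard ≤ {x | x ∈ l}.ncard := by rw [hnd.ncard_setOf_mem, hcard, hlen]
    exact Set.eq_of_subset_of_ncard_le hsub hle hfin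
  refine ⟨fun i => l.get (i.cast hlen.symm), ?_, ?_, fun i hi => ?_⟩
  · exact (List.nodup_iff_injective_get.1 hnd).comp (Fin.cast_injective _)
  · rw [← hl, ← Set.range_list_get]
    exact (finCongr hlen.symm).surjective.range_comp l.get
  · exact List.isChain_iff_getElem.1 hch i (by omega)
end

section
/- Let V be a nonzero finite-dimensional K-vector space and let X, Y, Z : V → V be linear maps satisfying the 𝒜-relations such that the only subspaces of V invariant under all of X, Y, Z are 0 and V. Then X is diagonalizable, and the set L = {λ ∈ K : ker(X − λ·id) ≠ 0} of eigenvalues of X is connected. -/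
/-- The only subspaces of `V` invariant under all of `X, Y, Z` are `0` and `V`. -/
def OnlyTrivialInvariant {K V : Type*} [Field K] [AddCommGroup V] [Module K V]
    (X Y Z : V →ₗ[K] V) : Prop :=
  ∀ W : Submodule K V, (∀ v ∈ W, X v ∈ W) → (∀ v ∈ W, Y v ∈ W) →
    (∀ v ∈ W, Z v ∈ W) → W = ⊥ ∨ W = ⊤

theorem eigSp_eq_eigenspace {K V : Type*} [Field K] [AddCommGroup V] [Module K V]
    (f : V →ₗ[K] V) (μ : K) : eigSp f μ = Module.End.eigenspace f μ := by
  ext v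
  rw [mem_eigSp_iff, Module.End.mem_eigenspace_iff]

/-- `Y` maps the `μ`-eigenspace of `X` into the sum of the eigenspaces for `2 - μ` and
`-2 - μ`, because `X²Y + 2XYX + YX² = 4Y`. -/
theorem ARels.apply_mem_sup {K V : Type*} [Field K] [CharZero K] [AddCommGroup V] [Module K V]
    {X Y Z : V →ₗ[K] V} (hrel : ARels X Y Z) {μ : K} {v : V} (hv : v ∈ eigSp X μ) :
    Y v ∈ eigSp X (2 - μ) ⊔ eigSp X (-2 - μ) := by
  obtain ⟨hXY, -, hZX⟩ := hrel
  rw [mem_eigSp_iff] at hv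
  have hZ : X (Y v) + μ • Y v = (2 : K) • Z v := by
    simpa [hv] using LinearMap.congr_fun hXY v
  have hY : μ • Z v + X (Z v) = (2 : K) • Y v := by
    simpa [hv] using LinearMap.congr_fun hZX v
  have hXZ : X (X (Y v)) + μ • X (Y v) = (2 : K) • X (Z v) := by
    simpa using congrArg X hZ
  have hquad : X (X (Y v)) = (4 - μ ^ 2) • Y v - (2 * μ) • X (Y v) := by
    linear_combination (norm := module) hXZ + μ • hZ + (2 : K) • hY
  rw [Submodule.mem_sup]
  refine ⟨(4⁻¹ : K) • (X (Y v) + (μ + 2) • Y v), ?_,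
    (4⁻¹ : K) • ((2 - μ) • Y v - X (Y v)), ?_, ?_⟩
  · rw [mem_eigSp_iff]
    simp only [map_smul, map_add, hquad]
    module
  · rw [mem_eigSp_iff]
    simp only [map_smul, map_sub, hquad]
    module
  · module

/-- If `S` contains an eigenvalue of `X` and, with each `μ`, those of `2 - μ` and `-2 - μ` that
are eigenvalues, then the eigenspaces for `S` span the irreducible module. -/
theorem ARels.iSup_eigSp_eq_top {K V : Type*} [Field K] [CharZero K]
    [AddCommGroup V] [Module K V] {X Y Z : V →ₗ[K] V} (hrel : ARels X Y Z)
    (hirr : OnlyTrivialInvariant X Y Z) {S : Set K}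
    (hS : ∀ μ ∈ S, ∀ ν, μ + ν = 2 ∨ μ + ν = -2 → eigSp X ν ≠ ⊥ → ν ∈ S)
    (hne : ∃ μ ∈ S, eigSp X μ ≠ ⊥) : ⨆ μ ∈ S, eigSp X μ = ⊤ := by
  set W : Submodule K V := ⨆ μ ∈ S, eigSp X μ with hW
  have hle : ∀ μ ∈ S, eigSp X μ ≤ W := fun μ hμ => le_iSup₂_of_le μ hμ le_rfl
  have hle' : ∀ μ ∈ S, ∀ ν, μ + ν = 2 ∨ μ + ν = -2 → eigSp X ν ≤ W := by
    intro μ hμ ν hν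
    by_cases h : eigSp X ν = ⊥
    · rw [h]; exact bot_le
    · exact hle ν (hS μ hμ ν hν h)
  have hX : W ≤ W.comap X := by
    refine iSup₂_le fun μ hμ v hv => ?_
    rw [Submodule.mem_comap, mem_eigSp_iff.mp hv]
    exact W.smul_mem μ (hle μ hμ hv)
  have hY : W ≤ W.comap Y := by
    refine iSup₂_le fun μ hμ v hv => ?_
    exact sup_le (hle' μ hμ _ (Or.inl (by ring))) (hle' μ hμ _ (Or.inr (by ring)))
      (hrel.apply_mem_sup hv)
  have hZ : ∀ v ∈ W, Z v ∈ W := by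
    intro v hv
    have h : X (Y v) + Y (X v) = (2 : K) • Z v := by
      simpa using LinearMap.congr_fun hrel.1 v
    rw [← W.smul_mem_iff (two_ne_zero (α := K)), ← h]
    exact W.add_mem (hX (hY hv)) (hY (hX hv))
  refine (hirr W (fun v hv => hX hv) (fun v hv => hY hv) hZ).resolve_left fun hbot => ?_
  obtain ⟨μ, hμ, h⟩ := hne
  exact h (le_bot_iff.mp (hbot ▸ hle μ hμ))

/-- Let `V` be a nonzero finite-dimensional `K`-vector space
and let `X, Y, Z` be linear maps on `V` satisfying the 𝒜-relations such that
the only invariant subspaces are `0` and `V`.  Then `X` is diagonalizable and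
the set of eigenvalues of `X` is connected. -/
theorem stmt5 {K V : Type*} [Field K] [IsAlgClosed K] [CharZero K]
    [AddCommGroup V] [Module K V] [FiniteDimensional K V] [Nontrivial V]
    (X Y Z : V →ₗ[K] V) (hrel : ARels X Y Z)
    (hirr : OnlyTrivialInvariant X Y Z) :
    (⨆ μ : K, eigSp X μ) = ⊤ ∧
    ConnectedSet {μ : K | eigSp X μ ≠ ⊥} := by
  have hex : ∃ μ : K, eigSp X μ ≠ ⊥ := by
    obtain ⟨μ, hμ⟩ := Module.End.exists_eigenvalue X
    exact ⟨μ, by rw [eigSp_eq_eigenspace]; exact hμ⟩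
  refine ⟨?_, hex, ?_⟩
  · obtain ⟨μ, hμ⟩ := hex
    simpa using hrel.iSup_eigSp_eq_top hirr (S := Set.univ) (by simp) ⟨μ, trivial, hμ⟩
  · rintro M₁ M₂ hunion hdisj ⟨μ, hμ⟩ ⟨σ, hσ⟩
    by_contra! hadj
    have hM : ∀ ν, ν ∈ M₁ ∪ M₂ ↔ eigSp X ν ≠ ⊥ := fun ν => by rw [hunion]; rfl
    have htop := hrel.iSup_eigSp_eq_top hirr (S := M₁)
      (fun ρ hρ ν hν hne => ((hM ν).mpr hne).resolve_right fun hν₂ =>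
        hadj ρ hρ ν hν₂ ⟨fun h => hdisj.notMem_of_mem_left hρ (h ▸ hν₂), hν⟩)
      ⟨μ, hμ, (hM μ).mp (Or.inl hμ)⟩
    have hind : iSupIndep (eigSp X) := by
      rw [funext (eigSp_eq_eigenspace X)]
      exact Module.End.eigenspaces_iSupIndep X
    have hd := hind.disjoint_biSup (x := σ) (y := M₁) (hdisj.notMem_of_mem_right hσ)
    rw [htop, disjoint_top] at hd
    exact (hM σ).mp (Or.inr hσ) hd
end

section
/- Let d be a nonnegative even integer and let X, Y, Z be the linear maps on K^{d+1} with standard basis v_0,…,v_d defined by X v_i = (−1)^i (d−2i) v_i, Y v_i = (d−i+1) v_{i−1} + (i+1) v_{i+1}, Z v_i = (−1)^{i−1}(d−i+1) v_{i−1} + (−1)^i (i+1) v_{i+1} for 0 ≤ i ≤ d, where v_{−1} = 0 and v_{d+1} = 0. Then X, Y, Z satisfy the 𝒜-relations, and the only subspaces of K^{d+1} invariant under all of X, Y, Z are 0 and K^{d+1}. -/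
/-- The matrix of `X` for the module of type `B(d)`:
`X v_i = (−1)^i (d − 2i) v_i`. -/
def matBX (K : Type*) [Field K] (d : ℕ) : Matrix (Fin (d + 1)) (Fin (d + 1)) K :=
  fun j i =>
    if j = i then ((((-1 : ℤ) ^ (i : ℕ)) * ((d : ℤ) - 2 * ((i : ℕ) : ℤ)) : ℤ) : K)
    else 0

/-- The matrix of `Y` for the module of type `B(d)`:
`Y v_i = (d − i + 1) v_{i−1} + (i + 1) v_{i+1}` with `v_{−1} = 0`, `v_{d+1} = 0`. -/
def matBY (K : Type*) [Field K] (d : ℕ) : Matrix (Fin (d + 1)) (Fin (d + 1)) K :=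
  fun j i =>
    if (j : ℕ) + 1 = (i : ℕ) then (((d : ℤ) - ((i : ℕ) : ℤ) + 1 : ℤ) : K)
    else if (i : ℕ) + 1 = (j : ℕ) then ((((i : ℕ) : ℤ) + 1 : ℤ) : K)
    else 0

/-- The matrix of `Z` for the module of type `B(d)`:
`Z v_i = (−1)^{i−1}(d − i + 1) v_{i−1} + (−1)^i (i + 1) v_{i+1}`
with `v_{−1} = 0`, `v_{d+1} = 0`. -/
def matBZ (K : Type*) [Field K] (d : ℕ) : Matrix (Fin (d + 1)) (Fin (d + 1)) K :=
  fun j i =>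
    if (j : ℕ) + 1 = (i : ℕ) then
      ((((-1 : ℤ) ^ ((i : ℕ) + 1)) * ((d : ℤ) - ((i : ℕ) : ℤ) + 1) : ℤ) : K)
    else if (i : ℕ) + 1 = (j : ℕ) then
      ((((-1 : ℤ) ^ (i : ℕ)) * (((i : ℕ) : ℤ) + 1) : ℤ) : K)
    else 0

/-- The matrix of `X` for the module of type `AB(d,0)`:
`X v_i = (−1)^{d+i}(2d − 2i + 1) v_i`. -/
def matABX (K : Type*) [Field K] (d : ℕ) : Matrix (Fin (d + 1)) (Fin (d + 1)) K :=
  fun j i =>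
    if j = i then
      ((((-1 : ℤ) ^ (d + (i : ℕ))) * (2 * (d : ℤ) - 2 * ((i : ℕ) : ℤ) + 1) : ℤ) : K)
    else 0

/-- The matrix of `Y` for the module of type `AB(d,0)`:
`Y v_i = (−1)^d (2d − i + 2) v_{i−1} + (−1)^d (i + 1) v_{i+1}`
with `v_{−1} = 0`, `v_{d+1} = v_d`. -/
def matABY (K : Type*) [Field K] (d : ℕ) : Matrix (Fin (d + 1)) (Fin (d + 1)) K :=
  fun j i =>
    if (j : ℕ) + 1 = (i : ℕ) then
      ((((-1 : ℤ) ^ d) * (2 * (d : ℤ) - ((i : ℕ) : ℤ) + 2) : ℤ) : K)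
    else if (i : ℕ) + 1 = (j : ℕ) then
      ((((-1 : ℤ) ^ d) * (((i : ℕ) : ℤ) + 1) : ℤ) : K)
    else if j = i ∧ (i : ℕ) = d then
      ((((-1 : ℤ) ^ d) * ((d : ℤ) + 1) : ℤ) : K)
    else 0

/-- The matrix of `Z` for the module of type `AB(d,0)`:
`Z v_i = (−1)^{i−1}(2d − i + 2) v_{i−1} + (−1)^i (i + 1) v_{i+1}`
with `v_{−1} = 0`, `v_{d+1} = v_d`. -/
def matABZ (K : Type*) [Field K] (d : ℕ) : Matrix (Fin (d + 1)) (Fin (d + 1)) K :=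
  fun j i =>
    if (j : ℕ) + 1 = (i : ℕ) then
      ((((-1 : ℤ) ^ ((i : ℕ) + 1)) * (2 * (d : ℤ) - ((i : ℕ) : ℤ) + 2) : ℤ) : K)
    else if (i : ℕ) + 1 = (j : ℕ) then
      ((((-1 : ℤ) ^ (i : ℕ)) * (((i : ℕ) : ℤ) + 1) : ℤ) : K)
    else if j = i ∧ (i : ℕ) = d then
      ((((-1 : ℤ) ^ (i : ℕ)) * ((d : ℤ) + 1) : ℤ) : K)
    else 0

/-- The standard basis vector `v_n` of `K^{d+1}`, extended by zero to all integers `n`. -/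
def stdVec (K : Type*) [Field K] (d : ℕ) (n : ℤ) : Fin (d + 1) → K :=
  fun k => if ((k : ℕ) : ℤ) = n then 1 else 0

section

variable {K : Type*} [Field K] {d : ℕ}

theorem stdVec_natCast (i : Fin (d + 1)) : stdVec K d (i : ℕ) = Pi.single i 1 := by
  ext k
  simp [stdVec, Pi.single_apply, Fin.ext_iff]

theorem stdVec_eq_zero {n : ℤ} (hn : n < 0 ∨ (d : ℤ) < n) : stdVec K d n = 0 := by
  ext k
  have := k.isLt
  simp only [stdVec, Pi.zero_apply, ite_eq_right_iff]
  intro h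
  omega

theorem stdVec_cases (n : ℤ) :
    (∃ i : Fin (d + 1), n = (i : ℕ)) ∨ n < 0 ∨ (d : ℤ) < n := by
  by_cases h : n < 0 ∨ (d : ℤ) < n
  · exact Or.inr h
  · exact Or.inl ⟨⟨n.toNat, by omega⟩, by simp only; omega⟩

theorem toLin'_matBX_stdVec (n : ℤ) :
    Matrix.toLin' (matBX K d) (stdVec K d n) =
      ((-1 : K) ^ n * (d - 2 * n)) • stdVec K d n := by
  rcases stdVec_cases (d := d) n with ⟨i, rfl⟩ | h
  · rw [stdVec_natCast, Matrix.toLin'_apply, Matrix.mulVec_single_one]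
    ext k
    by_cases hk : k = i <;> simp [matBX, hk]
  · simp [stdVec_eq_zero h]

theorem smul_stdVec_sub_one_eq_zero {n : ℤ} (hn : n < 0 ∨ (d : ℤ) < n) :
    ((d : K) - n + 1) • stdVec K d (n - 1) = 0 := by
  by_cases h : n = d + 1
  · simp [h]
  · rw [stdVec_eq_zero (by omega), smul_zero]

theorem smul_stdVec_add_one_eq_zero {n : ℤ} (hn : n < 0 ∨ (d : ℤ) < n) :
    ((n : K) + 1) • stdVec K d (n + 1) = 0 := by
  by_cases h : n = -1
  · simp [h]
  · rw [stdVec_eq_zero (by omega), smul_zero]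

theorem toLin'_matBY_stdVec (n : ℤ) :
    Matrix.toLin' (matBY K d) (stdVec K d n) =
      ((d : K) - n + 1) • stdVec K d (n - 1) + ((n : K) + 1) • stdVec K d (n + 1) := by
  rcases stdVec_cases (d := d) n with ⟨i, rfl⟩ | h
  · rw [stdVec_natCast, Matrix.toLin'_apply, Matrix.mulVec_single_one]
    ext k
    have h₁ : ((k : ℕ) : ℤ) = (i : ℕ) - 1 ↔ (k : ℕ) + 1 = i := by omega
    have h₂ : ((k : ℕ) : ℤ) = (i : ℕ) + 1 ↔ (i : ℕ) + 1 = k := by omega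
    simp only [Matrix.col_apply, matBY, stdVec, Pi.add_apply, Pi.smul_apply, h₁, h₂]
    split_ifs <;> first | omega | simp
  · rw [smul_stdVec_sub_one_eq_zero h, smul_stdVec_add_one_eq_zero h, stdVec_eq_zero h,
      map_zero, add_zero]

theorem toLin'_matBZ_stdVec (n : ℤ) :
    Matrix.toLin' (matBZ K d) (stdVec K d n) =
      (-1 : K) ^ n • (((n : K) + 1) • stdVec K d (n + 1) -
        ((d : K) - n + 1) • stdVec K d (n - 1)) := by
  rcases stdVec_cases (d := d) n with ⟨i, rfl⟩ | h
  · rw [stdVec_natCast, Matrix.toLin'_apply, Matrix.mulVec_single_one]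
    ext k
    have h₁ : ((k : ℕ) : ℤ) = (i : ℕ) - 1 ↔ (k : ℕ) + 1 = i := by omega
    have h₂ : ((k : ℕ) : ℤ) = (i : ℕ) + 1 ↔ (i : ℕ) + 1 = k := by omega
    simp only [Matrix.col_apply, matBZ, stdVec, Pi.sub_apply, Pi.smul_apply, h₁, h₂]
    split_ifs <;> first | omega | (simp [pow_succ]; try ring)
  · rw [smul_stdVec_sub_one_eq_zero h, smul_stdVec_add_one_eq_zero h, stdVec_eq_zero h,
      map_zero, sub_zero, smul_zero]

theorem linearMap_ext_stdVec {M : Type*} [AddCommGroup M] [Module K M]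
    {f g : (Fin (d + 1) → K) →ₗ[K] M} (h : ∀ n : ℤ, f (stdVec K d n) = g (stdVec K d n)) :
    f = g := by
  refine (Pi.basisFun K (Fin (d + 1))).ext fun i => ?_
  simpa [stdVec_natCast] using h (i : ℕ)

theorem aRels_matB (K : Type*) [Field K] (d : ℕ) :
    ARels (Matrix.toLin' (matBX K d)) (Matrix.toLin' (matBY K d))
      (Matrix.toLin' (matBZ K d)) := by
  have hs (n : ℤ) : (-1 : K) ^ (n + 1) = -(-1 : K) ^ n := by
    rw [zpow_add_one₀ (by simp)]; ring
  have hp (n : ℤ) : (-1 : K) ^ (n - 1) = -(-1 : K) ^ n := by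
    rw [zpow_sub_one₀ (by simp)]; simp
  have hq (n : ℤ) : (-1 : K) ^ n * (-1 : K) ^ n = 1 := by
    rw [← mul_zpow]; simp
  refine ⟨linearMap_ext_stdVec fun n => ?_, linearMap_ext_stdVec fun n => ?_,
    linearMap_ext_stdVec fun n => ?_⟩ <;>
  simp only [LinearMap.add_apply, LinearMap.comp_apply, LinearMap.smul_apply, map_add, map_sub,
    map_smul, toLin'_matBX_stdVec, toLin'_matBY_stdVec, toLin'_matBZ_stdVec, hs, hp,
    add_sub_cancel_right, sub_add_cancel]
  · push_cast
    module
  · push_cast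
    module
  · push_cast
    linear_combination (norm := module) (hq n) • ((2 : K) •
      ((d - n + 1 : K) • stdVec K d (n - 1) + (n + 1 : K) • stdVec K d (n + 1)))

/-- A subspace of `K^n` stable under multiplication by a function with distinct values contains
every basis vector on which one of its elements is supported. -/
theorem single_mem_of_mul_mem {ι : Type*} [Fintype ι] [DecidableEq ι] {c : ι → K}
    (hc : Function.Injective c) {W : Submodule K (ι → K)} (hW : ∀ v ∈ W, c * v ∈ W)
    {v : ι → K} (hv : v ∈ W) {i : ι} (hi : v i ≠ 0) : Pi.single i 1 ∈ W := by
  have key (s : Finset ι) : (fun k => (∏ j ∈ s, (c k - c j)) * v k) ∈ W := by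
    induction s using Finset.induction_on with
    | empty => simpa using hv
    | insert a s ha ih =>
      convert W.sub_mem (hW _ ih) (W.smul_mem (c a) ih) using 1
      ext k
      simp only [Finset.prod_insert ha, Pi.sub_apply, Pi.mul_apply, Pi.smul_apply, smul_eq_mul]
      ring
  have hne : (∏ j ∈ Finset.univ.erase i, (c i - c j)) * v i ≠ 0 :=
    mul_ne_zero (Finset.prod_ne_zero_iff.2 fun j hj =>
      sub_ne_zero.2 (hc.ne (Finset.ne_of_mem_erase hj).symm)) hi
  rw [← W.smul_mem_iff hne]
  convert key (Finset.univ.erase i) using 1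
  ext k
  by_cases hk : k = i
  · subst hk; simp
  · have h0 : ∏ j ∈ Finset.univ.erase i, (c k - c j) = 0 :=
      Finset.prod_eq_zero (Finset.mem_erase.2 ⟨hk, Finset.mem_univ k⟩) (sub_self (c k))
    simp [hk, h0]

theorem eigenvalue_matBX_injective [CharZero K] (hd : Even d) :
    Function.Injective fun i : Fin (d + 1) =>
      ((((-1 : ℤ) ^ (i : ℕ)) * ((d : ℤ) - 2 * ((i : ℕ) : ℤ)) : ℤ) : K) := by
  intro i j h
  have h' := Int.cast_injective h
  obtain ⟨e, rfl⟩ := hd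
  rcases Nat.even_or_odd (i : ℕ) with hi | hi <;> rcases Nat.even_or_odd (j : ℕ) with hj | hj <;>
  · simp only [hi.neg_one_pow, hj.neg_one_pow] at h'
    obtain ⟨a, ha⟩ := hi
    obtain ⟨b, hb⟩ := hj
    omega

theorem onlyTrivialInvariant_matB [CharZero K] (hd : Even d) :
    OnlyTrivialInvariant (Matrix.toLin' (matBX K d)) (Matrix.toLin' (matBY K d))
      (Matrix.toLin' (matBZ K d)) := by
  intro W hX hY hZ
  refine or_iff_not_imp_left.2 fun hW => ?_
  obtain ⟨v, hv, hv0⟩ := W.ne_bot_iff.1 hW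
  obtain ⟨i, hi⟩ := Function.ne_iff.1 hv0
  have hi_mem : stdVec K d (i : ℕ) ∈ W := by
    rw [stdVec_natCast]
    refine single_mem_of_mul_mem (eigenvalue_matBX_injective hd) (fun w hw => ?_) hv hi
    convert hX w hw using 1
    ext k
    simp [Matrix.toLin'_apply, Matrix.mulVec, dotProduct, matBX]
  have hsq (n : ℤ) : (-1 : K) ^ n * (-1 : K) ^ n = 1 := by
    rw [← mul_zpow]; simp
  have up (n : ℤ) (hn : 0 ≤ n) (h : stdVec K d n ∈ W) : stdVec K d (n + 1) ∈ W := by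
    have hne : (2 * (n + 1) : K) ≠ 0 := by exact_mod_cast (by omega : 2 * (n + 1) ≠ 0)
    rw [← W.smul_mem_iff hne]
    convert W.add_mem (hY _ h) (W.smul_mem ((-1 : K) ^ n) (hZ _ h)) using 1
    rw [toLin'_matBY_stdVec, toLin'_matBZ_stdVec, smul_smul, hsq]
    module
  have down (n : ℤ) (hn : n ≤ d) (h : stdVec K d n ∈ W) : stdVec K d (n - 1) ∈ W := by
    have hne : (2 * (d - n + 1) : K) ≠ 0 := by exact_mod_cast (by omega : 2 * (d - n + 1) ≠ 0)
    rw [← W.smul_mem_iff hne]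
    convert W.sub_mem (hY _ h) (W.smul_mem ((-1 : K) ^ n) (hZ _ h)) using 1
    rw [toLin'_matBY_stdVec, toLin'_matBZ_stdVec, smul_smul, hsq]
    module
  have all (n : ℤ) : 0 ≤ n ∧ n ≤ d → stdVec K d n ∈ W := by
    induction n using Int.inductionOn' (b := ((i : ℕ) : ℤ)) with
    | zero => exact fun _ => hi_mem
    | succ k hk ih => exact fun hn => up k (by omega) (ih (by omega))
    | pred k hk ih => exact fun hn => down k (by omega) (ih (by omega))
  rw [eq_top_iff, ← (Pi.basisFun K (Fin (d + 1))).span_eq, Submodule.span_le]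
  rintro _ ⟨j, rfl⟩
  rw [Pi.basisFun_apply, ← stdVec_natCast]
  exact all _ (by omega)

end

/-- For `d` a nonnegative even integer, the linear maps
`X, Y, Z` on `K^{d+1}` of type `B(d)` satisfy the 𝒜-relations, and the only
subspaces of `K^{d+1}` invariant under all of `X, Y, Z` are `0` and `K^{d+1}`. -/
theorem stmt6 (K : Type*) [Field K] [IsAlgClosed K] [CharZero K]
    (d : ℕ) (hd : Even d) :
    ARels (Matrix.toLin' (matBX K d)) (Matrix.toLin' (matBY K d))
      (Matrix.toLin' (matBZ K d)) ∧
    OnlyTrivialInvariant (Matrix.toLin' (matBX K d)) (Matrix.toLin' (matBY K d))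
      (Matrix.toLin' (matBZ K d)) := by
  exact ⟨aRels_matB K d, onlyTrivialInvariant_matB hd⟩
end

section
/- Let d be a nonnegative integer and let X, Y, Z be the linear maps on K^{d+1} with standard basis v_0,…,v_d defined by X v_i = (−1)^{d+i}(2d−2i+1) v_i, Y v_i = (−1)^d (2d−i+2) v_{i−1} + (−1)^d (i+1) v_{i+1}, Z v_i = (−1)^{i−1}(2d−i+2) v_{i−1} + (−1)^i (i+1) v_{i+1} for 0 ≤ i ≤ d, where v_{−1} = 0 and v_{d+1} = v_d. Then X, Y, Z satisfy the 𝒜-relations, and the only subspaces of K^{d+1} invariant under all of X, Y, Z are 0 and K^{d+1}. -/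
/-- The extension of a vector indexed by `0, …, d` by reflection about `d + 1/2`. -/
def reflectExtend {K : Type*} {d : ℕ} (v : Fin (d + 1) → K) (m : ℕ) : K :=
  v ⟨min m (2 * d + 1 - m), by omega⟩

theorem reflectExtend_val {K : Type*} {d : ℕ} (v : Fin (d + 1) → K) (j : Fin (d + 1)) :
    reflectExtend v j = v j :=
  congrArg v (Fin.ext (by have := j.isLt; simp only; omega))

/-- The tridiagonal matrix with superdiagonal entries `α` and subdiagonal entries `β`, in which
the superdiagonal entry leaving the last row is folded back onto the diagonal. -/
def foldedTridiagonal {K : Type*} [Field K] (d : ℕ) (α β : ℕ → K) :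
    Matrix (Fin (d + 1)) (Fin (d + 1)) K :=
  fun j i =>
    if (j : ℕ) + 1 = (i : ℕ) then α j
    else if (i : ℕ) + 1 = (j : ℕ) then β j
    else if j = i ∧ (i : ℕ) = d then α j
    else 0

theorem foldedTridiagonal_mulVec {K : Type*} [Field K] (d : ℕ) (α β : ℕ → K) (hβ : β 0 = 0)
    (v : Fin (d + 1) → K) (j : Fin (d + 1)) :
    (foldedTridiagonal d α β).mulVec v j =
      α j * reflectExtend v (j + 1) + β j * reflectExtend v (j - 1) := by
  have hj := j.isLt
  have key : ∀ k : Fin (d + 1), foldedTridiagonal d α β j k * v k =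
      (if k = ⟨min (j + 1) (2 * d + 1 - (j + 1)), by omega⟩ then α j * v k else 0) +
      (if k = ⟨min (j - 1) (2 * d + 1 - (j - 1)), by omega⟩ then β j * v k else 0) := by
    intro k
    have hk := k.isLt
    rcases Nat.eq_zero_or_pos (j : ℕ) with h0 | h0
    · simp only [foldedTridiagonal, Fin.ext_iff, h0, hβ]
      split_ifs <;> first | contradiction | omega | simp
    · simp only [foldedTridiagonal, Fin.ext_iff]
      split_ifs <;> first | contradiction | omega | simp
  simp only [Matrix.mulVec, dotProduct, key, Finset.sum_add_distrib, Finset.sum_ite_eq',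
    Finset.mem_univ, if_true, reflectExtend]

theorem matABY_eq_foldedTridiagonal (K : Type*) [Field K] (d : ℕ) :
    matABY K d = foldedTridiagonal d (fun j => (-1) ^ d * (2 * (d : K) + 1 - j))
      (fun j => (-1) ^ d * (j : K)) := by
  ext j i
  simp only [matABY, foldedTridiagonal]
  split_ifs with h₁ h₂ h₃
  · rw [← h₁]; push_cast; ring
  · rw [← h₂]; push_cast; ring
  · rw [h₃.1, h₃.2]; push_cast; ring
  · rfl

theorem matABZ_eq_foldedTridiagonal (K : Type*) [Field K] (d : ℕ) :
    matABZ K d = foldedTridiagonal d (fun j => (-1) ^ j * (2 * (d : K) + 1 - j))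
      (fun j => (-1) ^ (j + 1) * (j : K)) := by
  ext j i
  simp only [matABZ, foldedTridiagonal]
  split_ifs with h₁ h₂ h₃
  · rw [← h₁]; push_cast; ring
  · rw [← h₂]; push_cast; ring
  · rw [h₃.1, h₃.2]; push_cast; ring
  · rfl

theorem matABY_mulVec {K : Type*} [Field K] {d : ℕ} (v : Fin (d + 1) → K) (j : Fin (d + 1)) :
    (matABY K d).mulVec v j = (-1) ^ d * (2 * (d : K) + 1 - (j : ℕ)) * reflectExtend v (j + 1) +
      (-1) ^ d * ((j : ℕ) : K) * reflectExtend v (j - 1) := by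
  rw [matABY_eq_foldedTridiagonal, foldedTridiagonal_mulVec _ _ _ (by simp)]

theorem matABZ_mulVec {K : Type*} [Field K] {d : ℕ} (v : Fin (d + 1) → K) (j : Fin (d + 1)) :
    (matABZ K d).mulVec v j =
      (-1) ^ (j : ℕ) * (2 * (d : K) + 1 - (j : ℕ)) * reflectExtend v (j + 1) +
      (-1) ^ ((j : ℕ) + 1) * ((j : ℕ) : K) * reflectExtend v (j - 1) := by
  rw [matABZ_eq_foldedTridiagonal, foldedTridiagonal_mulVec _ _ _ (by simp)]

theorem matABX_eq_diagonal (K : Type*) [Field K] (d : ℕ) :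
    matABX K d = Matrix.diagonal
      (fun i : Fin (d + 1) => (-1) ^ (d + (i : ℕ)) * (2 * (d : K) - 2 * (i : ℕ) + 1)) := by
  ext j i
  by_cases h : j = i
  · subst h; simp [matABX]
  · simp [matABX, h]

theorem matABX_mulVec {K : Type*} [Field K] {d : ℕ} (v : Fin (d + 1) → K) (j : Fin (d + 1)) :
    (matABX K d).mulVec v j = (-1) ^ (d + (j : ℕ)) * (2 * (d : K) - 2 * (j : ℕ) + 1) * v j := by
  rw [matABX_eq_diagonal, Matrix.mulVec_diagonal]

theorem matAB_aRels (K : Type*) [Field K] (d : ℕ) :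
    ARels (Matrix.toLin' (matABX K d)) (Matrix.toLin' (matABY K d))
      (Matrix.toLin' (matABZ K d)) := by
  have hlast : ∀ v : Fin (d + 1) → K, reflectExtend v (d + 1) = reflectExtend v d := fun v =>
    congrArg v (Fin.ext (by simp only; omega))
  have hlast_add_one : ∀ v : Fin (d + 1) → K,
      reflectExtend v (d + 1 + 1) = reflectExtend v (d - 1) := fun v =>
    congrArg v (Fin.ext (by simp only; omega))
  have hX : ∀ (v : Fin (d + 1) → K) (m : ℕ), m ≤ d + 1 →
      reflectExtend ((matABX K d).mulVec v) m =
        (-1) ^ (d + m) * (2 * (d : K) - 2 * m + 1) * reflectExtend v m := by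
    intro v m hm
    have hle : ∀ m ≤ d, reflectExtend ((matABX K d).mulVec v) m =
        (-1) ^ (d + m) * (2 * (d : K) - 2 * m + 1) * reflectExtend v m := by
      intro m hm
      have := matABX_mulVec v ⟨m, by omega⟩
      rwa [← reflectExtend_val (Matrix.mulVec _ _), ← reflectExtend_val v] at this
    rcases Nat.lt_or_eq_of_le hm with hm | rfl
    · exact hle m (by omega)
    · rw [hlast, hle d le_rfl, hlast]
      push_cast; ring
  have hY : ∀ (v : Fin (d + 1) → K) (m : ℕ), m ≤ d + 1 →
      reflectExtend ((matABY K d).mulVec v) m =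
        (-1) ^ d * (2 * (d : K) + 1 - m) * reflectExtend v (m + 1) +
          (-1) ^ d * (m : K) * reflectExtend v (m - 1) := by
    intro v m hm
    have hle : ∀ m ≤ d, reflectExtend ((matABY K d).mulVec v) m =
        (-1) ^ d * (2 * (d : K) + 1 - m) * reflectExtend v (m + 1) +
          (-1) ^ d * (m : K) * reflectExtend v (m - 1) := by
      intro m hm
      have := matABY_mulVec v ⟨m, by omega⟩
      rwa [← reflectExtend_val (Matrix.mulVec _ _)] at this
    rcases Nat.lt_or_eq_of_le hm with hm | rfl
    · exact hle m (by omega)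
    · rw [hlast, hle d le_rfl, hlast, hlast_add_one, Nat.add_sub_cancel]
      push_cast; ring
  have hZ : ∀ (v : Fin (d + 1) → K) (m : ℕ), m ≤ d + 1 →
      reflectExtend ((matABZ K d).mulVec v) m =
        (-1) ^ m * (2 * (d : K) + 1 - m) * reflectExtend v (m + 1) +
          (-1) ^ (m + 1) * (m : K) * reflectExtend v (m - 1) := by
    intro v m hm
    have hle : ∀ m ≤ d, reflectExtend ((matABZ K d).mulVec v) m =
        (-1) ^ m * (2 * (d : K) + 1 - m) * reflectExtend v (m + 1) +
          (-1) ^ (m + 1) * (m : K) * reflectExtend v (m - 1) := by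
      intro m hm
      have := matABZ_mulVec v ⟨m, by omega⟩
      rwa [← reflectExtend_val (Matrix.mulVec _ _)] at this
    rcases Nat.lt_or_eq_of_le hm with hm | rfl
    · exact hle m (by omega)
    · rw [hlast, hle d le_rfl, hlast, hlast_add_one, Nat.add_sub_cancel]
      push_cast; ring
  have hsq : ∀ m : ℕ, (-1 : K) ^ (m * 2) = 1 := fun m => by simp [mul_comm m, pow_mul]
  refine ⟨?_, ?_, ?_⟩ <;> refine LinearMap.ext fun v => funext fun j => ?_ <;>
    simp only [LinearMap.add_apply, LinearMap.comp_apply, LinearMap.smul_apply,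
      Matrix.toLin'_apply, Pi.add_apply, Pi.smul_apply, smul_eq_mul] <;>
    rw [← reflectExtend_val (Matrix.mulVec _ _) j, ← reflectExtend_val (Matrix.mulVec _ _) j,
      ← reflectExtend_val (Matrix.mulVec _ _) j] <;>
    generalize hj : (j : ℕ) = m <;>
    have hm : m ≤ d := by have := j.isLt; omega
  all_goals
    rcases m with _ | m <;>
    · simp (disch := omega) only [hX, hY, hZ, Nat.add_sub_cancel]
      push_cast
      ring_nf <;> simp only [hsq] <;> ring

/-- A subspace stable under a diagonal matrix with distinct eigenvalues contains every basis
vector occurring in one of its elements. -/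
theorem single_mem_of_diagonal_invariant {K ι : Type*} [Field K] [Fintype ι] [DecidableEq ι]
    {x : ι → K} (hx : Function.Injective x) {W : Submodule K (ι → K)}
    (hW : ∀ v ∈ W, (Matrix.diagonal x).mulVec v ∈ W) {v : ι → K} (hv : v ∈ W) {i : ι}
    (hi : v i ≠ 0) : Pi.single i 1 ∈ W := by
  have hpoly : ∀ p : Polynomial K, ∀ w ∈ W, (fun j => p.eval (x j) * w j) ∈ W := by
    intro p
    induction p using Polynomial.induction_on' with
    | add p q hp hq =>
      intro w hw
      convert W.add_mem (hp w hw) (hq w hw) using 1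
      ext j; simp [add_mul]
    | monomial n a =>
      induction n with
      | zero =>
        intro w hw
        convert W.smul_mem a hw using 1
        ext j; simp
      | succ n ih =>
        intro w hw
        convert ih _ (hW w hw) using 1
        ext j
        simp only [Polynomial.eval_monomial, Matrix.mulVec_diagonal]
        ring
  convert hpoly (Lagrange.interpolate Finset.univ x (Pi.single i (v i)⁻¹)) v hv using 1
  ext j
  rw [Lagrange.eval_interpolate_at_node _ hx.injOn (Finset.mem_univ j)]
  by_cases h : j = i
  · subst h; simp [hi]
  · simp [h]

theorem injective_signed_odd (K : Type*) [Field K] [CharZero K] (d : ℕ) :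
    Function.Injective
      (fun i : Fin (d + 1) => (-1) ^ (d + (i : ℕ)) * (2 * (d : K) - 2 * (i : ℕ) + 1)) := by
  intro i j h
  have hsq : (2 * (d : K) - 2 * (i : ℕ) + 1) ^ 2 = (2 * (d : K) - 2 * (j : ℕ) + 1) ^ 2 := by
    have := congrArg (· ^ 2) h
    simpa only [mul_pow, ← pow_mul, mul_comm _ 2, pow_mul (-1 : K) 2, neg_one_sq, one_pow,
      one_mul] using this
  have hint : (2 * (d : ℤ) - 2 * (i : ℕ) + 1) ^ 2 = (2 * (d : ℤ) - 2 * (j : ℕ) + 1) ^ 2 := by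
    exact_mod_cast hsq
  have hi := i.isLt
  have hj := j.isLt
  rcases sq_eq_sq_iff_eq_or_eq_neg.mp hint with h | h <;> exact Fin.ext (by omega)

theorem matAB_onlyTrivialInvariant (K : Type*) [Field K] [CharZero K] (d : ℕ) :
    OnlyTrivialInvariant (Matrix.toLin' (matABX K d)) (Matrix.toLin' (matABY K d))
      (Matrix.toLin' (matABZ K d)) := by
  intro W hX hY _
  simp only [Matrix.toLin'_apply, matABX_eq_diagonal] at hX hY
  have hsingle := fun {v} hv {i} =>
    single_mem_of_diagonal_invariant (injective_signed_odd K d) hX (v := v) hv (i := i)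
  by_cases hbot : W = ⊥
  · exact Or.inl hbot
  right
  obtain ⟨v, hv, hv0⟩ := W.exists_mem_ne_zero_of_ne_bot hbot
  obtain ⟨i, hi⟩ := Function.ne_iff.mp hv0
  have hmem : Pi.single i 1 ∈ W := hsingle hv hi
  have hstep : ∀ k l : Fin (d + 1), matABY K d l k ≠ 0 →
      Pi.single k 1 ∈ W → Pi.single l 1 ∈ W := by
    intro k l hkl hk
    refine hsingle (hY _ hk) ?_
    simpa using hkl
  have hsucc : ∀ m (h : m + 1 < d + 1), (Pi.single (⟨m, by omega⟩ : Fin (d + 1)) (1 : K)) ∈ W ↔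
      (Pi.single (⟨m + 1, h⟩ : Fin (d + 1)) (1 : K)) ∈ W := by
    intro m h
    constructor <;> refine hstep _ _ ?_
    · have h' : ¬ m + 1 + 1 = m := by omega
      simp only [matABY, h', if_false, if_true]
      exact Int.cast_ne_zero.mpr (mul_ne_zero (by simp) (by omega))
    · simp only [matABY, if_true]
      exact Int.cast_ne_zero.mpr (mul_ne_zero (by simp) (by push_cast; omega))
  have hzero : ∀ m (h : m < d + 1), (Pi.single (⟨m, h⟩ : Fin (d + 1)) (1 : K)) ∈ W ↔
      (Pi.single (0 : Fin (d + 1)) (1 : K)) ∈ W := by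
    intro m
    induction m with
    | zero => intro _; rfl
    | succ m ih => intro h; rw [← hsucc m h, ih]
  have hall : ∀ k : Fin (d + 1), (Pi.single k (1 : K)) ∈ W := fun k =>
    (hzero k k.isLt).mpr ((hzero i i.isLt).mp hmem)
  refine eq_top_iff.mpr fun w _ => ?_
  rw [pi_eq_sum_univ' w]
  exact W.sum_mem fun k _ => W.smul_mem _ <|
    by simpa [Pi.single_apply, eq_comm, funext_iff] using hall k

/-- For `d` a nonnegative integer, the linear maps `X, Y, Z`
on `K^{d+1}` of type `AB(d,0)` satisfy the 𝒜-relations, and the only subspaces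
of `K^{d+1}` invariant under all of `X, Y, Z` are `0` and `K^{d+1}`. -/
theorem stmt7 (K : Type*) [Field K] [IsAlgClosed K] [CharZero K] (d : ℕ) :
    ARels (Matrix.toLin' (matABX K d)) (Matrix.toLin' (matABY K d))
      (Matrix.toLin' (matABZ K d)) ∧
    OnlyTrivialInvariant (Matrix.toLin' (matABX K d))
      (Matrix.toLin' (matABY K d)) (Matrix.toLin' (matABZ K d)) := by
  exact ⟨matAB_aRels K d, matAB_onlyTrivialInvariant K d⟩
end

section
/- Let V be a nonzero finite-dimensional K-vector space and let X, Y, Z : V → V be linear maps satisfying the 𝒜-relations such that the only subspaces of V invariant under all of X, Y, Z are 0 and V. Set d + 1 = dim V. Then (V, X, Y, Z) is isomorphic to exactly one module among the five families B(d) (this case requires d even), AB(d,0), AB(d,x), AB(d,y), AB(d,z): that is, there exists a K-linear bijection φ : V → K^{d+1} with φ∘X = X'∘φ, φ∘Y = Y'∘φ, φ∘Z = Z'∘φ, where (X', Y', Z') is the triple of maps of exactly one of these five types, and no such bijection exists for any of the other four types. -/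
/-- The `X`-matrix of the five types `B(d)`, `AB(d,0)`, `AB(d,x)`, `AB(d,y)`,
`AB(d,z)` (in this order); `AB(d,x)` negates `Y, Z`, `AB(d,y)` negates `X, Z`,
`AB(d,z)` negates `X, Y`. -/
def typeX (K : Type*) [Field K] (d : ℕ) :
    Fin 5 → Matrix (Fin (d + 1)) (Fin (d + 1)) K
  | 0 => matBX K d
  | 1 => matABX K d
  | 2 => matABX K d
  | 3 => -(matABX K d)
  | 4 => -(matABX K d)

/-- The `Y`-matrix of the five types. -/
def typeY (K : Type*) [Field K] (d : ℕ) :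
    Fin 5 → Matrix (Fin (d + 1)) (Fin (d + 1)) K
  | 0 => matBY K d
  | 1 => matABY K d
  | 2 => -(matABY K d)
  | 3 => matABY K d
  | 4 => -(matABY K d)

/-- The `Z`-matrix of the five types. -/
def typeZ (K : Type*) [Field K] (d : ℕ) :
    Fin 5 → Matrix (Fin (d + 1)) (Fin (d + 1)) K
  | 0 => matBZ K d
  | 1 => matABZ K d
  | 2 => -(matABZ K d)
  | 3 => -(matABZ K d)
  | 4 => matABZ K d

open Module

/-- Some linear equivalence with `K^{d+1}` carries `(X, Y, Z)` to the matrices `(A, B, C)`. -/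
def HasModel {K V : Type*} [Field K] [AddCommGroup V] [Module K V] {d : ℕ}
    (X Y Z : V →ₗ[K] V) (A B C : Matrix (Fin (d + 1)) (Fin (d + 1)) K) : Prop :=
  ∃ φ : V ≃ₗ[K] (Fin (d + 1) → K),
    (∀ v, φ (X v) = Matrix.toLin' A (φ v)) ∧
    (∀ v, φ (Y v) = Matrix.toLin' B (φ v)) ∧
    (∀ v, φ (Z v) = Matrix.toLin' C (φ v))

/-- The sequence `v` shifted by one, with `v_{-1} = 0`. -/
def shiftDown {V : Type*} [Zero V] (v : ℕ → V) : ℕ → V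
  | 0 => 0
  | i + 1 => v i

/-- The common shape of the modules `B(d)` (`c = d`) and `AB(d,0)` (`c = 2d + 1`, up to sign). -/
structure IsLadder {K V : Type*} [Field K] [AddCommGroup V] [Module K V]
    (X Y Z : V →ₗ[K] V) (c : K) (v : ℕ → V) : Prop where
  mapX : ∀ i : ℕ, X (v i) = ((-1) ^ i * (c - 2 * i)) • v i
  mapY : ∀ i : ℕ, Y (v i) = (c - i + 1) • shiftDown v i + ((i : K) + 1) • v (i + 1)
  mapZ : ∀ i : ℕ, Z (v i) = ((-1) ^ (i + 1) * (c - i + 1)) • shiftDown v i +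
    ((-1) ^ i * ((i : K) + 1)) • v (i + 1)

section

variable {K V : Type*} [Field K] [AddCommGroup V] [Module K V]
variable {X Y Z : V →ₗ[K] V} {d : ℕ}

namespace ARels

lemma neg_XY (h : ARels X Y Z) : ARels (-X) (-Y) Z := by
  obtain ⟨h1, h2, h3⟩ := h
  refine ⟨?_, ?_, ?_⟩
  · rw [← h1]; simp only [LinearMap.comp_neg, LinearMap.neg_comp, neg_neg]
  · rw [smul_neg, ← h2]; simp only [LinearMap.comp_neg, LinearMap.neg_comp]; abel
  · rw [smul_neg, ← h3]; simp only [LinearMap.comp_neg, LinearMap.neg_comp]; abel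

lemma apply_XY (h : ARels X Y Z) (v : V) : X (Y v) = (2 : K) • Z v - Y (X v) := by
  have := LinearMap.congr_fun h.1 v
  simp only [LinearMap.add_apply, LinearMap.comp_apply, LinearMap.smul_apply] at this
  rw [← this]; abel

lemma apply_YZ (h : ARels X Y Z) (v : V) : Y (Z v) = (2 : K) • X v - Z (Y v) := by
  have := LinearMap.congr_fun h.2.1 v
  simp only [LinearMap.add_apply, LinearMap.comp_apply, LinearMap.smul_apply] at this
  rw [← this]; abel

lemma apply_XZ (h : ARels X Y Z) (v : V) : X (Z v) = (2 : K) • Y v - Z (X v) := by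
  have := LinearMap.congr_fun h.2.2 v
  simp only [LinearMap.add_apply, LinearMap.comp_apply, LinearMap.smul_apply] at this
  rw [← this]; abel

/-- `Y + sZ` with `s = ±1` sends the `μ`-eigenspace of `X` to the `(2s - μ)`-eigenspace. -/
lemma apply_X_ladder (h : ARels X Y Z) {s μ : K} (hs : s * s = 1) {v : V} (hv : X v = μ • v) :
    X (Y v + s • Z v) = (2 * s - μ) • (Y v + s • Z v) := by
  rw [map_add, map_smul, h.apply_XY, h.apply_XZ, hv, map_smul, map_smul]
  match_scalars
  · linear_combination (-2 : K) * hs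
  · ring

end ARels

lemma OnlyTrivialInvariant.neg_XY (h : OnlyTrivialInvariant X Y Z) :
    OnlyTrivialInvariant (-X) (-Y) Z := by
  intro W hX hY hZ
  refine h W (fun v hv => ?_) (fun v hv => ?_) hZ
  · simpa using hX v hv
  · simpa using hY v hv

/-- The Casimir element `X² + Y² + Z²` acts as a scalar. -/
lemma ARels.exists_casimir [IsAlgClosed K] [FiniteDimensional K V] [Nontrivial V]
    (h : ARels X Y Z) (hirr : OnlyTrivialInvariant X Y Z) :
    ∃ ω : K, ∀ v, X (X v) + Y (Y v) + Z (Z v) = ω • v := by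
  let Ω : End K V := X ∘ₗ X + Y ∘ₗ Y + Z ∘ₗ Z
  obtain ⟨ω, hω⟩ := Module.End.exists_eigenvalue Ω
  have key : ∀ v, v ∈ End.eigenspace Ω ω ↔ X (X v) + Y (Y v) + Z (Z v) = ω • v := fun v => by
    rw [End.mem_eigenspace_iff]; rfl
  refine ⟨ω, fun v => (key v).1 ?_⟩
  have hYX : ∀ v, Y (X v) = (2 : K) • Z v - X (Y v) := fun v => by rw [h.apply_XY]; abel
  have hZY : ∀ v, Z (Y v) = (2 : K) • X v - Y (Z v) := fun v => by rw [h.apply_YZ]; abel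
  have hZX : ∀ v, Z (X v) = (2 : K) • Y v - X (Z v) := fun v => by rw [h.apply_XZ]; abel
  have hW := hirr (End.eigenspace Ω ω) ?_ ?_ ?_
  · rw [hW.resolve_left hω]; trivial
  all_goals
    intro v hv
    rw [key] at hv ⊢
    rw [← map_smul, ← hv]
    simp only [map_add, map_sub, map_smul, hYX, hZY, hZX]
    module

lemma ARels.ladder_sq (h : ARels X Y Z) {ω s μ : K}
    (hω : ∀ v, X (X v) + Y (Y v) + Z (Z v) = ω • v) (hs : s * s = 1) {v : V} (hv : X v = μ • v) :
    Y (Y v + s • Z v) + s • Z (Y v + s • Z v) = (ω + 1 - (μ - s) ^ 2) • v := by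
  have h1 := hω v
  rw [hv, map_smul, hv] at h1
  have h2 : Z (Z v) = ω • v - μ • μ • v - Y (Y v) := by rw [← h1]; abel
  simp only [map_add, map_smul, h.apply_YZ, hv, h2]
  match_scalars
  · linear_combination (-1) * hs
  · linear_combination (ω - μ ^ 2 + 1) * hs
  · ring

/-- Some eigenvector of `X` is killed by `Y - Z` or by `Y + Z`. -/
lemma ARels.exists_extremal [IsAlgClosed K] [CharZero K] [FiniteDimensional K V] [Nontrivial V]
    (h : ARels X Y Z) :
    ∃ (μ : K) (v : V), v ≠ 0 ∧ X v = μ • v ∧ (Y v = Z v ∨ Y v = -Z v) := by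
  by_contra! hcon
  obtain ⟨μ, hμ⟩ := Module.End.exists_eigenvalue X
  have hup : ∀ k : ℕ, End.HasEigenvalue X (μ + 4 * k) := by
    intro k
    induction k with
    | zero => simpa using hμ
    | succ k ih =>
      obtain ⟨v, hv⟩ := ih.exists_hasEigenvector
      have hv0 := hv.2
      have hvX := hv.apply_eq_smul
      set w := Y v + (-1 : K) • Z v with hw
      have hwX := h.apply_X_ladder (s := -1) (by norm_num) hvX
      rw [← hw] at hwX
      have hw0 : w ≠ 0 := fun h0 => (hcon _ v hv0 hvX).1 <| by
        rw [hw, neg_one_smul, ← sub_eq_add_neg, sub_eq_zero] at h0; exact h0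
      have huX := h.apply_X_ladder (s := 1) (by norm_num) hwX
      have hu0 : Y w + (1 : K) • Z w ≠ 0 := fun h0 => (hcon _ w hw0 hwX).2 <| by
        rw [one_smul] at h0; exact eq_neg_of_add_eq_zero_left h0
      refine End.hasEigenvalue_of_hasEigenvector (x := Y w + (1 : K) • Z w)
        ⟨End.mem_eigenspace_iff.2 ?_, hu0⟩
      rw [huX]
      congr 1
      push_cast
      ring
  have hfin : Set.Finite {a | End.HasEigenvalue X a} := End.finite_hasEigenvalue X
  refine Set.infinite_of_injective_forall_mem (f := fun k : ℕ => μ + 4 * (k : K)) ?_ hup hfin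
  intro a b hab
  simpa using hab

/-- The sequence generated from `v` by alternately applying `Y + Z` and `Y - Z`. -/
def ladder (Y Z : V →ₗ[K] V) (v : V) : ℕ → V
  | 0 => v
  | i + 1 => (2 * ((i : K) + 1))⁻¹ • (Y (ladder Y Z v i) + (-1 : K) ^ i • Z (ladder Y Z v i))

lemma ARels.isLadder_ladder [CharZero K] (h : ARels X Y Z) {ω c : K}
    (hω : ∀ v, X (X v) + Y (Y v) + Z (Z v) = ω • v) {v : V} (hv0 : v ≠ 0)
    (hvX : X v = c • v) (hYZ : Y v = Z v) : IsLadder X Y Z c (ladder Y Z v) := by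
  set u := ladder Y Z v with hu
  have hsgn : ∀ i : ℕ, ((-1 : K) ^ i) * (-1) ^ i = 1 := fun i => by
    rw [← mul_pow]; norm_num
  have hne : ∀ i : ℕ, (2 * ((i : K) + 1)) ≠ 0 := fun i => by
    have : ((i : K) + 1) ≠ 0 := by exact_mod_cast Nat.succ_ne_zero i
    simpa using this
  have hsucc : ∀ i : ℕ, u (i + 1) = (2 * ((i : K) + 1))⁻¹ • (Y (u i) + (-1 : K) ^ i • Z (u i)) :=
    fun i => rfl
  have hdown : ∀ i : ℕ, Y (u i) + (-1 : K) ^ i • Z (u i) = (2 * ((i : K) + 1)) • u (i + 1) :=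
    fun i => by rw [hsucc, smul_inv_smul₀ (hne i)]
  have hX : ∀ i : ℕ, X (u i) = ((-1) ^ i * (c - 2 * i)) • u i := by
    intro i
    induction i with
    | zero => simpa [hu, ladder] using hvX
    | succ i ih =>
      rw [hsucc, map_smul, h.apply_X_ladder (hsgn i) ih, smul_comm]
      congr 2
      push_cast
      ring
  have hωc : ω + 1 = (c + 1) ^ 2 := by
    have h1 := h.ladder_sq hω (s := -1) (by norm_num) hvX
    rw [hYZ, neg_one_smul, add_neg_cancel, map_zero, map_zero, smul_zero, add_zero] at h1
    have := (smul_eq_zero.1 h1.symm).resolve_right hv0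
    linear_combination this
  have hup : ∀ i : ℕ, Y (u i) - (-1 : K) ^ i • Z (u i) = (2 * (c - i + 1)) • shiftDown u i := by
    intro i
    cases i with
    | zero => simp [hu, ladder, shiftDown, hYZ]
    | succ i =>
      have h1 := h.ladder_sq hω (hsgn i) (hX i)
      rw [hdown, map_smul, map_smul, smul_comm _ (2 * ((i : K) + 1)), ← smul_add] at h1
      have h2 := congrArg (fun x => (2 * ((i : K) + 1))⁻¹ • x) h1
      simp only [inv_smul_smul₀ (hne i)] at h2
      rw [pow_succ, mul_neg_one, neg_smul, sub_neg_eq_add, h2, smul_smul]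
      change _ = _ • u i
      congr 1
      rw [inv_mul_eq_iff_eq_mul₀ (hne i), hωc]
      push_cast
      linear_combination (-(c - 2 * i - 1) ^ 2) * hsgn i
  have h2 : (2 : K) ≠ 0 := two_ne_zero
  refine ⟨hX, fun i => ?_, fun i => ?_⟩
  · have : (2 : K) • Y (u i) =
        (2 : K) • ((c - i + 1) • shiftDown u i + ((i : K) + 1) • u (i + 1)) := by
      rw [smul_add, smul_smul, smul_smul, ← hup, ← hdown]; module
    exact smul_right_injective V h2 this
  · have : (2 : K) • Z (u i) = (2 : K) • (((-1) ^ (i + 1) * (c - i + 1)) • shiftDown u i +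
        ((-1) ^ i * ((i : K) + 1)) • u (i + 1)) := by
      have e1 : (2 : K) • (((-1) ^ (i + 1) * (c - i + 1)) • shiftDown u i +
          ((-1) ^ i * ((i : K) + 1)) • u (i + 1)) =
          (-1 : K) ^ i • ((2 * ((i : K) + 1)) • u (i + 1) -
            (2 * (c - i + 1)) • shiftDown u i) := by
        match_scalars <;> ring
      rw [e1, ← hup, ← hdown]
      match_scalars
      · linear_combination (-2 : K) * hsgn i
      · ring
    exact smul_right_injective V h2 this

namespace IsLadder

variable {c : K} {v : ℕ → V}

lemma neg_YZ (h : IsLadder X Y Z c v) :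
    IsLadder X (-Y) (-Z) c (fun i => (-1 : K) ^ i • v i) := by
  have hs : ∀ i, shiftDown (fun i => (-1 : K) ^ i • v i) i = -((-1 : K) ^ i • shiftDown v i) := by
    intro i
    cases i with
    | zero => simp [shiftDown]
    | succ i => simp only [shiftDown]; rw [pow_succ]; simp
  refine ⟨fun i => ?_, fun i => ?_, fun i => ?_⟩
  · rw [map_smul, h.mapX, smul_comm]
  · rw [hs, map_smul, LinearMap.neg_apply, h.mapY]
    match_scalars <;> ring
  · rw [hs, map_smul, LinearMap.neg_apply, h.mapZ]
    match_scalars <;> ring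

/-- A first `v_n` depending on its predecessors makes these span an invariant subspace. -/
lemma linearIndependent (h : IsLadder X Y Z c v) (hv : v 0 ≠ 0)
    [FiniteDimensional K V] (hirr : OnlyTrivialInvariant X Y Z) {n : ℕ} (hn : n ≤ finrank K V) :
    LinearIndependent K (fun i : Fin n => v i) := by
  induction n with
  | zero => exact linearIndependent_empty_type
  | succ n ih =>
    rw [linearIndependent_finSucc']
    refine ⟨ih (by lia), fun hmem => ?_⟩
    set W := Submodule.span K (Set.range fun i : Fin n => v i) with hW
    change v n ∈ Submodule.span K (Set.range fun i : Fin n => v i) at hmem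
    rw [← hW] at hmem
    have hle : ∀ i ≤ n, v i ∈ W := fun i hi => by
      rcases hi.lt_or_eq with hi | rfl
      · exact Submodule.subset_span ⟨⟨i, hi⟩, rfl⟩
      · exact hmem
    have hsd : ∀ i ≤ n, shiftDown v i ∈ W := fun i hi => by
      cases i with
      | zero => exact W.zero_mem
      | succ i => exact hle i (by lia)
    have hinv : ∀ T : V →ₗ[K] V, (∀ i < n, T (v i) ∈ W) → ∀ w ∈ W, T w ∈ W := fun T hT w hw => by
      have : W ≤ W.comap T := by
        rw [hW, Submodule.span_le]
        rintro _ ⟨i, rfl⟩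
        exact hT i i.2
      exact this hw
    have hWX := hinv X fun i hi => by
      rw [h.mapX]; exact W.smul_mem _ (hle i hi.le)
    have hWY := hinv Y fun i hi => by
      rw [h.mapY]; exact W.add_mem (W.smul_mem _ (hsd i hi.le)) (W.smul_mem _ (hle _ hi))
    have hWZ := hinv Z fun i hi => by
      rw [h.mapZ]; exact W.add_mem (W.smul_mem _ (hsd i hi.le)) (W.smul_mem _ (hle _ hi))
    rcases hirr W hWX hWY hWZ with h0 | h1
    · exact hv (by simpa [h0] using hle 0 (Nat.zero_le n))
    · have hcard := finrank_range_le_card (R := K) (fun i : Fin n => v i)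
      rw [Set.finrank, ← hW, h1, finrank_top, Fintype.card_fin] at hcard
      lia

/-- The ways in which a ladder can close up. -/
lemma closure_cases [CharZero K] (h : IsLadder X Y Z c v) (b : Basis (Fin (d + 1)) K V)
    (hb : ∀ i, b i = v i) :
    (c = d ∧ v (d + 1) = 0) ∨
      (c = 2 * d + 1 ∧ (v (d + 1) = v d ∨ v (d + 1) = -v d)) := by
  have hsgn : ∀ i : ℕ, ((-1 : K) ^ i) * (-1) ^ i = 1 := fun i => by
    rw [← mul_pow]; norm_num
  have hv : ∀ i : ℕ, i < d + 1 → v i ≠ 0 := fun i hi => by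
    rw [← hb ⟨i, hi⟩]; exact b.ne_zero _
  have h2 : (2 : K) ≠ 0 := two_ne_zero
  have hraise : Y (v (d + 1)) + (-1 : K) ^ d • Z (v (d + 1)) = (2 * (c - d)) • v d := by
    rw [h.mapY, h.mapZ]
    simp only [shiftDown]
    match_scalars
    · linear_combination (c - d) * hsgn d
    · linear_combination (-(d + 1 + 1)) * hsgn d
  rcases eq_or_ne (v (d + 1)) 0 with h0 | h0
  · refine Or.inl ⟨?_, h0⟩
    rw [h0, map_zero, map_zero, smul_zero, add_zero] at hraise
    have := (smul_eq_zero.1 hraise.symm).resolve_right (hv d (by lia))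
    exact sub_eq_zero.1 ((mul_eq_zero.1 this).resolve_left h2)
  right
  have hcoord : ∀ i : Fin (d + 1), b.repr (v (d + 1)) i ≠ 0 →
      c = d + 1 + (i : ℕ) ∧ (-1 : K) ^ (i : ℕ) = (-1) ^ d := by
    intro i hi
    have e1 : b.repr (X (v (d + 1))) i =
        ((-1) ^ (i : ℕ) * (c - 2 * (i : ℕ))) * b.repr (v (d + 1)) i := by
      have hlin : (b.coord i) ∘ₗ X = ((-1) ^ (i : ℕ) * (c - 2 * (i : ℕ))) • b.coord i := by
        refine b.ext fun j => ?_
        simp only [LinearMap.comp_apply, LinearMap.smul_apply, Basis.coord_apply]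
        rw [hb j, h.mapX, ← hb j, map_smul]
        simp only [Basis.repr_self, Finsupp.smul_apply, smul_eq_mul, Finsupp.single_apply]
        split_ifs with hji
        · rw [hji]
        · simp
      exact LinearMap.congr_fun hlin (v (d + 1))
    rw [h.mapX, map_smul, Finsupp.smul_apply, smul_eq_mul] at e1
    have e2 := mul_right_cancel₀ hi e1
    have hlt := i.2
    rcases neg_one_pow_eq_or K (i : ℕ) with hs | hs <;>
      rcases neg_one_pow_eq_or K d with hs' | hs' <;>
      rw [pow_succ, hs, hs'] at e2 <;> rw [hs, hs']
    · exact ⟨mul_left_cancel₀ h2 (by push_cast at e2; linear_combination -e2), rfl⟩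
    · exfalso
      have : ((i : ℕ) : K) = ((d + 1 : ℕ) : K) :=
        mul_left_cancel₀ h2 (by push_cast at e2 ⊢; linear_combination e2)
      have := Nat.cast_injective this
      lia
    · exfalso
      have : ((i : ℕ) : K) = ((d + 1 : ℕ) : K) :=
        mul_left_cancel₀ h2 (by push_cast at e2 ⊢; linear_combination -e2)
      have := Nat.cast_injective this
      lia
    · exact ⟨mul_left_cancel₀ h2 (by push_cast at e2; linear_combination e2), rfl⟩
  obtain ⟨j, hj⟩ : ∃ j, b.repr (v (d + 1)) j ≠ 0 := by
    by_contra! hall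
    exact h0 (b.ext_elem fun i => by rw [hall i]; simp)
  obtain ⟨hc, hpar⟩ := hcoord j hj
  set a := b.repr (v (d + 1)) j with ha
  have hvj : v (d + 1) = a • v j := by
    rw [← hb]
    refine b.ext_elem fun i => ?_
    rw [map_smul, Basis.repr_self, Finsupp.smul_apply, Finsupp.single_apply]
    split_ifs with hji
    · rw [← hji]; simp [ha]
    · by_contra hne
      rw [smul_zero] at hne
      have h3 := (hcoord i hne).1
      rw [hc] at h3
      exact hji (Fin.ext (Nat.cast_injective (add_left_cancel h3)))
  have hlower : Y (v (d + 1)) + (-1 : K) ^ d • Z (v (d + 1)) =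
      (2 * ((j : ℕ) + 1 : K) * a) • v (j + 1) := by
    rw [hvj, map_smul, map_smul, h.mapY, h.mapZ, ← hpar]
    match_scalars
    · linear_combination (-a * (c - (j : ℕ) + 1)) * hsgn j
    · linear_combination (a * ((j : ℕ) + 1)) * hsgn j
  have hj1 : ((j : ℕ) + 1 : K) ≠ 0 := by exact_mod_cast Nat.succ_ne_zero (j : ℕ)
  have hvd : a • v (j + 1) = v d := by
    have e := hlower.symm.trans hraise
    rw [show 2 * (c - d) = 2 * ((j : ℕ) + 1 : K) by rw [hc]; ring, mul_smul] at e
    exact smul_right_injective V (mul_ne_zero h2 hj1) e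
  have hjd : (j : ℕ) = d := by
    by_contra hne
    have hlt : (j : ℕ) + 1 < d + 1 := by have := j.2; lia
    have e1 : b.repr (v d) (Fin.last d) = 1 := by
      have := hb (Fin.last d)
      rw [Fin.val_last] at this
      simp [← this]
    rw [← hvd, ← hb ⟨j + 1, hlt⟩] at e1
    have hjd : (⟨(j : ℕ) + 1, hlt⟩ : Fin (d + 1)) = Fin.last d := by
      by_contra hne'
      rw [map_smul, Basis.repr_self, Finsupp.smul_apply, Finsupp.single_eq_of_ne' hne'] at e1
      simp at e1
    have hjd' : (j : ℕ) + 1 = d := by simpa [Fin.ext_iff] using hjd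
    have hpow : (-1 : K) ^ d = (-1) ^ (j : ℕ) * (-1) := by rw [← pow_succ, hjd']
    rw [hpow] at hpar
    have : (-1 : K) ^ (j : ℕ) ≠ 0 := by simp
    exact this (mul_left_cancel₀ h2 (by linear_combination hpar))
  rw [hjd] at hc hvj hvd
  refine ⟨by rw [hc]; ring, ?_⟩
  rw [hvj, smul_smul] at hvd
  have ha2 : a * a = 1 := smul_left_injective K (hv d (by lia)) (by simpa using hvd)
  rcases mul_self_eq_one_iff.1 ha2 with ha1 | ha1
  · left; rw [hvj, ha1, one_smul]
  · right; rw [hvj, ha1, neg_one_smul]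

end IsLadder

/-- A tridiagonal column with entries `p`, `r`, `q`, where `r` occurs only in the last column. -/
lemma sum_tridiagonal (v : ℕ → V) (p q r : K) {i : ℕ} (hi : i < d + 1)
    (hlast : i = d → q • v (d + 1) = r • v d) :
    ∑ j : Fin (d + 1), (if (j : ℕ) + 1 = i then p else if i + 1 = (j : ℕ) then q
      else if (j : ℕ) = i ∧ i = d then r else 0) • v j = p • shiftDown v i + q • v (i + 1) := by
  rw [Fin.sum_univ_eq_sum_range (fun j => (if j + 1 = i then p else if i + 1 = j then q
      else if j = i ∧ i = d then r else 0) • v j)]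
  have hsplit : ∀ j : ℕ, (if j + 1 = i then p else if i + 1 = j then q
      else if j = i ∧ i = d then r else 0) • v j =
      (if j + 1 = i then p • v j else 0) + (if i + 1 = j then q • v j else 0) +
        (if i = j then (if i = d then r • v j else 0) else 0) := fun j => by
    split_ifs <;> first | lia | simp
  rw [Finset.sum_congr rfl fun j _ => hsplit j, Finset.sum_add_distrib, Finset.sum_add_distrib,
    Finset.sum_ite_eq, Finset.sum_ite_eq, if_pos (Finset.mem_range.2 hi), add_assoc]
  congr 1
  · cases i with
    | zero => simp [shiftDown]
    | succ i =>
      simp only [Nat.add_right_cancel_iff, shiftDown]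
      rw [Finset.sum_ite_eq', if_pos (Finset.mem_range.2 (by lia))]
  · rcases eq_or_ne i d with rfl | hid
    · rw [if_neg (by simp), if_pos rfl, zero_add, hlast rfl]
    · rw [if_pos (Finset.mem_range.2 (by lia)), if_neg hid, add_zero]

lemma hasModel_of_basis (b : Basis (Fin (d + 1)) K V) {A B C : Matrix (Fin (d + 1)) (Fin (d + 1)) K}
    (hX : ∀ i, X (b i) = ∑ j, A j i • b j) (hY : ∀ i, Y (b i) = ∑ j, B j i • b j)
    (hZ : ∀ i, Z (b i) = ∑ j, C j i • b j) : HasModel X Y Z A B C := by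
  have key : ∀ (T : V →ₗ[K] V) (M : Matrix (Fin (d + 1)) (Fin (d + 1)) K),
      (∀ i, T (b i) = ∑ j, M j i • b j) → ∀ v, b.equivFun (T v) = Matrix.toLin' M (b.equivFun v) := by
    intro T M hT v
    have : b.equivFun.toLinearMap ∘ₗ T = Matrix.toLin' M ∘ₗ b.equivFun.toLinearMap := by
      refine b.ext fun i => ?_
      ext k
      simp [hT, Finsupp.single_apply, Matrix.mulVec, dotProduct]
    exact LinearMap.congr_fun this v
  exact ⟨b.equivFun, key X A hX, key Y B hY, key Z C hZ⟩

lemma IsLadder.hasModel_B {v : ℕ → V} (h : IsLadder X Y Z (d : K) v) (b : Basis (Fin (d + 1)) K V)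
    (hb : ∀ i, b i = v i) (hlast : v (d + 1) = 0) :
    HasModel X Y Z (matBX K d) (matBY K d) (matBZ K d) := by
  refine hasModel_of_basis b (fun i => ?_) (fun i => ?_) (fun i => ?_)
  · rw [hb, h.mapX]
    simp [matBX, ite_smul, hb]
  · rw [hb, h.mapY, ← sum_tridiagonal v _ _ 0 i.2 (fun _ => by simp [hlast])]
    refine Finset.sum_congr rfl fun j _ => ?_
    rw [hb]; congr 1; simp [matBY]
  · rw [hb, h.mapZ, ← sum_tridiagonal v _ _ 0 i.2 (fun _ => by simp [hlast])]
    refine Finset.sum_congr rfl fun j _ => ?_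
    rw [hb]; congr 1; simp [matBZ]

/-- For odd `d` the sign `(-1)^d` of `X` and `Y` in `AB(d,0)` amounts to the type `AB(d,z)`. -/
lemma IsLadder.hasModel_AB {v : ℕ → V} (h : IsLadder X Y Z (2 * d + 1 : K) v)
    (b : Basis (Fin (d + 1)) K V) (hb : ∀ i, b i = v i) (hlast : v (d + 1) = v d) :
    HasModel X Y Z ((-1 : K) ^ d • matABX K d) ((-1 : K) ^ d • matABY K d) (matABZ K d) := by
  have hsgn : ((-1 : K) ^ d) * (-1) ^ d = 1 := by rw [← mul_pow]; norm_num
  refine hasModel_of_basis b (fun i => ?_) (fun i => ?_) (fun i => ?_)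
  · rw [hb, h.mapX]
    simp only [matABX, Matrix.smul_apply, smul_eq_mul, mul_ite, mul_zero, ite_smul, zero_smul, hb,
      Finset.sum_ite_eq', Finset.mem_univ, if_true]
    congr 1
    push_cast
    rw [pow_add]
    linear_combination (-(-1) ^ (i : ℕ) * (2 * d - 2 * (i : ℕ) + 1)) * hsgn
  · rw [hb, h.mapY, ← sum_tridiagonal v _ _ ((d : K) + 1) i.2]
    refine Finset.sum_congr rfl fun j _ => ?_
    rw [hb]; congr 1
    simp only [matABY, Matrix.smul_apply, smul_eq_mul, Fin.ext_iff]
    split_ifs <;> push_cast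
    · linear_combination (-(2 * d - (i : ℕ) + 2)) * hsgn
    · linear_combination (-((i : ℕ) + 1)) * hsgn
    · linear_combination (-(d + 1)) * hsgn
    · ring
    · intro hi
      rw [hlast, hi]
  · rw [hb, h.mapZ, ← sum_tridiagonal v _ _ ((-1) ^ (i : ℕ) * ((d : K) + 1)) i.2]
    refine Finset.sum_congr rfl fun j _ => ?_
    rw [hb]; congr 1
    simp only [matABZ, Fin.ext_iff]
    split_ifs <;> push_cast <;> ring
    · intro hi
      rw [hlast, hi]

lemma neg_one_pow_rev (R : Type*) [Ring R] (i : Fin (d + 1)) :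
    (-1 : R) ^ (i.rev : ℕ) = (-1) ^ d * (-1) ^ (i : ℕ) := by
  have hi : (i.rev : ℕ) + i = d := by rw [Fin.val_rev]; have := i.2; lia
  have hsgn : ((-1 : R) ^ (i : ℕ)) * (-1) ^ (i : ℕ) = 1 := by
    rw [← pow_add]; exact Even.neg_one_pow ⟨_, rfl⟩
  have hd : (-1 : R) ^ d = (-1) ^ (i.rev : ℕ) * (-1) ^ (i : ℕ) := by rw [← pow_add, hi]
  rw [hd, mul_assoc, hsgn, mul_one]

lemma cast_rev (i : Fin (d + 1)) : ((i.rev : ℕ) : ℤ) = d - (i : ℕ) := by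
  have := i.2
  rw [Fin.val_rev]; lia

lemma matBX_rev (i j : Fin (d + 1)) :
    matBX K d i.rev j.rev = -(-1) ^ d * matBX K d i j := by
  simp only [matBX, Fin.rev_inj, neg_one_pow_rev, cast_rev]
  split_ifs
  · push_cast; ring
  · simp

lemma rev_val_add_one (i j : Fin (d + 1)) :
    (i.rev : ℕ) + 1 = (j.rev : ℕ) ↔ (j : ℕ) + 1 = i := by
  have := i.2
  have := j.2
  rw [Fin.val_rev, Fin.val_rev]; lia

lemma matBY_rev (i j : Fin (d + 1)) : matBY K d i.rev j.rev = matBY K d i j := by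
  simp only [matBY, rev_val_add_one, cast_rev]
  split_ifs
  · lia
  all_goals push_cast; ring

lemma matBZ_rev (i j : Fin (d + 1)) :
    matBZ K d i.rev j.rev = -(-1) ^ d * matBZ K d i j := by
  simp only [matBZ, rev_val_add_one, cast_rev, pow_succ, neg_one_pow_rev]
  split_ifs
  · lia
  all_goals push_cast; ring

/-- For odd `d`, the symmetric vectors form a proper invariant subspace of `B(d)`. -/
lemma HasModel.even (h : HasModel X Y Z (matBX K d) (matBY K d) (matBZ K d)) [CharZero K]
    (hirr : OnlyTrivialInvariant X Y Z) : Even d := by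
  by_contra hd
  have hd1 : (-1 : K) ^ d = -1 := (Nat.not_even_iff_odd.1 hd).neg_one_pow
  obtain ⟨φ, hX, hY, hZ⟩ := h
  let W : Submodule K V :=
    { carrier := {v | ∀ i, φ v i.rev = φ v i}
      add_mem' := fun {a b} ha hb i => by simp [ha i, hb i]
      zero_mem' := fun i => by simp
      smul_mem' := fun r a ha i => by simp [ha i] }
  have hinv : ∀ (T : V →ₗ[K] V) (M : Matrix (Fin (d + 1)) (Fin (d + 1)) K),
      (∀ v, φ (T v) = Matrix.toLin' M (φ v)) → (∀ i j, M i.rev j.rev = M i j) →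
      ∀ v ∈ W, T v ∈ W := by
    intro T M hT hM v hv i
    simp only [hT, Matrix.toLin'_apply, Matrix.mulVec, dotProduct]
    rw [← Equiv.sum_comp Fin.revPerm]
    refine Finset.sum_congr rfl fun j _ => ?_
    rw [Fin.revPerm_apply, hM, hv j]
  have hd0 : d ≠ 0 := by rintro rfl; exact hd Even.zero
  have hne : Fin.last d ≠ 0 := by simpa [Fin.ext_iff] using hd0
  rcases hirr W (hinv X _ hX fun i j => by rw [matBX_rev, hd1]; ring)
    (hinv Y _ hY matBY_rev) (hinv Z _ hZ fun i j => by rw [matBZ_rev, hd1]; ring) with h0 | h1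
  · have hmem : φ.symm 1 ∈ W := fun i => by simp
    rw [h0, Submodule.mem_bot, LinearEquiv.map_eq_zero_iff] at hmem
    exact one_ne_zero hmem
  · have hmem : φ.symm (Pi.single 0 1) ∈ W := by rw [h1]; trivial
    have := hmem 0
    simp [hne] at this

lemma HasModel.of_neg_XY (h : HasModel (-X) (-Y) Z (matBX K d) (matBY K d) (matBZ K d))
    (hd : Even d) : HasModel X Y Z (matBX K d) (matBY K d) (matBZ K d) := by
  obtain ⟨φ, hX, hY, hZ⟩ := h
  have hd1 : (-1 : K) ^ d = 1 := hd.neg_one_pow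
  have hsgn : ∀ i : ℕ, ((-1 : K) ^ i) * (-1) ^ i = 1 := fun i => by
    rw [← mul_pow]; norm_num
  let flip : (Fin (d + 1) → K) →ₗ[K] (Fin (d + 1) → K) :=
    { toFun := fun f i => (-1) ^ (i : ℕ) * f i.rev
      map_add' := fun f g => by ext i; simp [mul_add]
      map_smul' := fun r f => by ext i; simp; ring }
  have hflip : ∀ f, flip (flip f) = f := fun f => by
    ext i
    change (-1 : K) ^ (i : ℕ) * ((-1) ^ (i.rev : ℕ) * f i.rev.rev) = f i
    rw [neg_one_pow_rev, hd1, one_mul, ← mul_assoc, hsgn, one_mul, Fin.rev_rev]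
  let ψ := φ.trans (LinearEquiv.ofInvolutive flip hflip)
  have key : ∀ (T : V →ₗ[K] V) (e : K) (M : Matrix (Fin (d + 1)) (Fin (d + 1)) K),
      (∀ v, φ (T v) = e • Matrix.toLin' M (φ v)) →
      (∀ i j : Fin (d + 1), e * M i.rev j.rev = (-1) ^ (i : ℕ) * M i j * (-1) ^ (j : ℕ)) →
      ∀ v, ψ (T v) = Matrix.toLin' M (ψ v) := by
    intro T e M hT hM v
    ext i
    change (-1 : K) ^ (i : ℕ) * φ (T v) i.rev =
      ∑ j, M i j * ((-1 : K) ^ (j : ℕ) * φ v j.rev)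
    rw [hT]
    change (-1 : K) ^ (i : ℕ) * (e * ∑ j, M i.rev j * φ v j) = _
    rw [← Equiv.sum_comp Fin.revPerm, Finset.mul_sum, Finset.mul_sum]
    refine Finset.sum_congr rfl fun j _ => ?_
    rw [Fin.revPerm_apply, ← mul_assoc e, hM]
    linear_combination (M i j * (-1) ^ (j : ℕ) * φ v j.rev) * hsgn i
  refine ⟨ψ, key X (-1) _ (fun v => ?_) fun i j => ?_, key Y (-1) _ (fun v => ?_) fun i j => ?_,
    key Z 1 _ (fun v => ?_) fun i j => ?_⟩
  · rw [← hX]; simp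
  · rw [matBX_rev, hd1]
    simp only [matBX]
    split_ifs with hij
    · subst hij; push_cast; linear_combination
        (-(-1) ^ (i : ℕ) * ((d : K) - 2 * (i : ℕ))) * hsgn i
    · simp
  · rw [← hY]; simp
  · rw [matBY_rev]
    simp only [matBY]
    split_ifs with hij hij
    · rw [← hij, pow_succ]
      push_cast
      linear_combination ((d : K) - ((i : ℕ) + 1) + 1) * hsgn i
    · rw [← hij, pow_succ]
      push_cast
      linear_combination ((j : ℕ) + 1 : K) * hsgn j
    · simp
  · rw [hZ, one_smul]
  · rw [matBZ_rev, hd1]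
    simp only [matBZ]
    split_ifs with hij hij
    · rw [← hij, pow_succ, pow_succ]
      push_cast
      linear_combination ((-1) ^ (i : ℕ) * ((d : K) - ((i : ℕ) + 1) + 1)) * hsgn i
    · rw [← hij, pow_succ]
      push_cast
      linear_combination ((-1) ^ (j : ℕ) * ((j : ℕ) + 1 : K)) * hsgn j
    · simp

lemma HasModel.smul {A B C : Matrix (Fin (d + 1)) (Fin (d + 1)) K} (h : HasModel X Y Z A B C)
    (p q r : K) : HasModel (p • X) (q • Y) (r • Z) (p • A) (q • B) (r • C) := by
  obtain ⟨φ, hX, hY, hZ⟩ := h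
  exact ⟨φ, fun v => by simp [hX], fun v => by simp [hY], fun v => by simp [hZ]⟩

/-- Existence of a model, given an eigenvector of `X` killed by `Y - Z`. -/
lemma ARels.hasModel_of_extremal [IsAlgClosed K] [CharZero K] [FiniteDimensional K V]
    (h : ARels X Y Z) (hirr : OnlyTrivialInvariant X Y Z) (hdim : finrank K V = d + 1)
    {μ : K} {v : V} (hv : v ≠ 0) (hvX : X v = μ • v) (hYZ : Y v = Z v) :
    HasModel X Y Z (matBX K d) (matBY K d) (matBZ K d) ∨
      ∃ s t : K, (s = 1 ∨ s = -1) ∧ (t = 1 ∨ t = -1) ∧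
        HasModel X Y Z (s • matABX K d) (t • matABY K d) ((s * t) • matABZ K d) := by
  have : Nontrivial V := ⟨v, 0, hv⟩
  obtain ⟨ω, hω⟩ := h.exists_casimir hirr
  have hlad := h.isLadder_ladder hω hv hvX hYZ
  set u := ladder Y Z v with hu
  have hli := hlad.linearIndependent (by simpa [hu, ladder] using hv) hirr hdim.ge
  have hcard : Fintype.card (Fin (d + 1)) = finrank K V := by rw [hdim, Fintype.card_fin]
  let b := basisOfLinearIndependentOfCardEqFinrank hli hcard
  have hb : ∀ i, b i = u i := fun i => by simp [b]
  have hsgn : ((-1 : K) ^ d) * (-1) ^ d = 1 := by rw [← mul_pow]; norm_num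
  have hpm := neg_one_pow_eq_or K d
  rcases hlad.closure_cases b hb with ⟨rfl, hlast⟩ | ⟨rfl, hlast | hlast⟩
  · exact Or.inl (hlad.hasModel_B b hb hlast)
  · refine Or.inr ⟨(-1) ^ d, (-1) ^ d, hpm, hpm, ?_⟩
    rw [hsgn, one_smul]
    exact hlad.hasModel_AB b hb hlast
  · refine Or.inr ⟨(-1) ^ d, -(-1) ^ d, hpm, ?_, ?_⟩
    · rcases hpm with h1 | h1 <;> simp [h1]
    let e : Fin (d + 1) → Kˣ := fun i => (-1) ^ (i : ℕ)
    have hmodel := hlad.neg_YZ.hasModel_AB (b.unitsSMul e)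
      (fun i => by simp [Basis.unitsSMul_apply, hb, e, Units.smul_def])
      (by simp [hlast, pow_succ])
    have := hmodel.smul 1 (-1) (-1)
    simpa [mul_neg, hsgn] using this

lemma HasModel.trace_eq {A B C : Matrix (Fin (d + 1)) (Fin (d + 1)) K}
    (h : HasModel X Y Z A B C) :
    LinearMap.trace K V Y = B.trace ∧ LinearMap.trace K V Z = C.trace := by
  obtain ⟨φ, -, hY, hZ⟩ := h
  have key : ∀ (T : V →ₗ[K] V) (M : Matrix (Fin (d + 1)) (Fin (d + 1)) K),
      (∀ v, φ (T v) = Matrix.toLin' M (φ v)) → LinearMap.trace K V T = M.trace := by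
    intro T M hT
    rw [← Matrix.trace_toLin'_eq, ← LinearMap.trace_conj' T φ]
    congr 1
    refine LinearMap.ext fun w => ?_
    rw [LinearEquiv.conj_apply_apply, hT, LinearEquiv.apply_symm_apply]
  exact ⟨key Y B hY, key Z C hZ⟩

lemma trace_matBY : (matBY K d).trace = 0 := by
  simp [Matrix.trace, matBY]

lemma trace_matBZ : (matBZ K d).trace = 0 := by
  simp [Matrix.trace, matBZ]

lemma trace_matABY : (matABY K d).trace = (-1) ^ d * (d + 1) := by
  rw [Matrix.trace, Finset.sum_eq_single (Fin.last d)]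
  · simp [matABY]
  · intro i _ hi
    have : (i : ℕ) ≠ d := fun h => hi (Fin.ext h)
    simp [matABY, this]
  · simp

lemma trace_matABZ : (matABZ K d).trace = (-1) ^ d * (d + 1) := by
  rw [Matrix.trace, Finset.sum_eq_single (Fin.last d)]
  · simp [matABZ]
  · intro i _ hi
    have : (i : ℕ) ≠ d := fun h => hi (Fin.ext h)
    simp [matABZ, this]
  · simp

/-- The traces of `Y` and `Z` separate the five types. -/
lemma HasModel.type_unique [CharZero K] {t t' : Fin 5}
    (h : HasModel X Y Z (typeX K d t) (typeY K d t) (typeZ K d t))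
    (h' : HasModel X Y Z (typeX K d t') (typeY K d t') (typeZ K d t')) : t = t' := by
  obtain ⟨hY, hZ⟩ := h.trace_eq
  obtain ⟨hY', hZ'⟩ := h'.trace_eq
  rw [hY] at hY'
  rw [hZ] at hZ'
  have hd : ((d : K) + 1) ≠ 0 := by exact_mod_cast Nat.succ_ne_zero d
  have hr : (-1 : K) ^ d * (d + 1) ≠ 0 := mul_ne_zero (by simp) hd
  have hr' : -((-1 : K) ^ d * (d + 1)) ≠ (-1) ^ d * (d + 1) := fun e => hr (neg_eq_self.1 e)
  generalize hrr : (-1 : K) ^ d * (d + 1) = r at hr hr'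
  fin_cases t <;> fin_cases t' <;>
    simp [typeY, typeZ, trace_matBY, trace_matBZ, trace_matABY, trace_matABZ, hrr, hr, hr',
      hr.symm, hr'.symm] at hY' hZ' ⊢

lemma ARels.exists_type [IsAlgClosed K] [CharZero K] [FiniteDimensional K V] [Nontrivial V]
    (h : ARels X Y Z) (hirr : OnlyTrivialInvariant X Y Z) (hdim : finrank K V = d + 1) :
    ∃ t, HasModel X Y Z (typeX K d t) (typeY K d t) (typeZ K d t) := by
  have hcases : HasModel X Y Z (matBX K d) (matBY K d) (matBZ K d) ∨
      ∃ s t : K, (s = 1 ∨ s = -1) ∧ (t = 1 ∨ t = -1) ∧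
        HasModel X Y Z (s • matABX K d) (t • matABY K d) ((s * t) • matABZ K d) := by
    obtain ⟨μ, v, hv, hvX, hYZ | hYZ⟩ := h.exists_extremal
    · exact h.hasModel_of_extremal hirr hdim hv hvX hYZ
    · rcases h.neg_XY.hasModel_of_extremal hirr.neg_XY hdim (μ := -μ) hv (by simp [hvX])
        (by simp [hYZ]) with hB | ⟨s, t, hs, ht, hAB⟩
      · exact Or.inl (hB.of_neg_XY (hB.even hirr.neg_XY))
      · refine Or.inr ⟨-s, -t, ?_, ?_, ?_⟩
        · rcases hs with rfl | rfl <;> simp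
        · rcases ht with rfl | rfl <;> simp
        · simpa using hAB.smul (-1) (-1) 1
  rcases hcases with hB | ⟨s, t, rfl | rfl, rfl | rfl, hAB⟩
  · exact ⟨0, hB⟩
  · exact ⟨1, by simpa [typeX, typeY, typeZ] using hAB⟩
  · exact ⟨2, by simpa [typeX, typeY, typeZ] using hAB⟩
  · exact ⟨3, by simpa [typeX, typeY, typeZ] using hAB⟩
  · exact ⟨4, by simpa [typeX, typeY, typeZ] using hAB⟩

end

/-- Let `V` be a nonzero finite-dimensional `K`-vector space
and let `X, Y, Z` be linear maps on `V` satisfying the 𝒜-relations whose only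
common invariant subspaces are `0` and `V`.  Set `d + 1 = dim V`.  Then
`(V, X, Y, Z)` is isomorphic to exactly one module among the five families
`B(d)` (this case requiring `d` even), `AB(d,0)`, `AB(d,x)`, `AB(d,y)`,
`AB(d,z)`. -/
theorem stmt8 {K V : Type*} [Field K] [IsAlgClosed K] [CharZero K]
    [AddCommGroup V] [Module K V] [FiniteDimensional K V] [Nontrivial V]
    (X Y Z : V →ₗ[K] V) (hrel : ARels X Y Z)
    (hirr : OnlyTrivialInvariant X Y Z)
    (d : ℕ) (hdim : Module.finrank K V = d + 1) :
    (∃! t : Fin 5, ∃ φ : V ≃ₗ[K] (Fin (d + 1) → K),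
        (∀ v, φ (X v) = Matrix.toLin' (typeX K d t) (φ v)) ∧
        (∀ v, φ (Y v) = Matrix.toLin' (typeY K d t) (φ v)) ∧
        (∀ v, φ (Z v) = Matrix.toLin' (typeZ K d t) (φ v))) ∧
    ((∃ φ : V ≃ₗ[K] (Fin (d + 1) → K),
        (∀ v, φ (X v) = Matrix.toLin' (typeX K d 0) (φ v)) ∧
        (∀ v, φ (Y v) = Matrix.toLin' (typeY K d 0) (φ v)) ∧
        (∀ v, φ (Z v) = Matrix.toLin' (typeZ K d 0) (φ v))) → Even d) := by
  obtain ⟨t, ht⟩ := hrel.exists_type hirr hdim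
  exact ⟨⟨t, ht, fun t' ht' => HasModel.type_unique ht' ht⟩, fun hB => HasModel.even hB hirr⟩
end

section
/- Let K be an algebraically closed field of characteristic zero, let d ≥ 1, let β ∈ K, and let θ_0, θ_1, …, θ_d be mutually distinct elements of K satisfying θ_{i−1}² − β θ_{i−1} θ_i + θ_i² = 0 for 1 ≤ i ≤ d. Then θ_0, …, θ_d form a geometric progression: there exists a nonzero q ∈ K with θ_i = q θ_{i−1} for 1 ≤ i ≤ d, and moreover q + q⁻¹ = β. -/
/-- Let `K` be an algebraically closed field of
characteristic zero, let `d ≥ 1`, let `β ∈ K`, and let `θ_0, …, θ_d` be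
mutually distinct elements of `K` with `θ_{i−1}² − β θ_{i−1} θ_i + θ_i² = 0`
for `1 ≤ i ≤ d`.  Then there exists a nonzero `q ∈ K` with `θ_i = q θ_{i−1}`
for `1 ≤ i ≤ d`, and `q + q⁻¹ = β`. -/
theorem stmt13 {K : Type*} [Field K] [IsAlgClosed K] [CharZero K]
    (d : ℕ) (hd : 1 ≤ d) (β : K) (θ : Fin (d + 1) → K)
    (hinj : Function.Injective θ)
    (hrec : ∀ i : ℕ, ∀ h1 : 1 ≤ i, ∀ h2 : i ≤ d,
      θ ⟨i - 1, by omega⟩ ^ 2 - β * θ ⟨i - 1, by omega⟩ * θ ⟨i, by omega⟩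
        + θ ⟨i, by omega⟩ ^ 2 = 0) :
    ∃ q : K, q ≠ 0 ∧
      (∀ i : ℕ, ∀ h1 : 1 ≤ i, ∀ h2 : i ≤ d,
        θ ⟨i, by omega⟩ = q * θ ⟨i - 1, by omega⟩) ∧
      q + q⁻¹ = β := by
  have step : ∀ i : ℕ, ∀ h : i < d,
      θ ⟨i, by omega⟩ ^ 2 - β * θ ⟨i, by omega⟩ * θ ⟨i + 1, by omega⟩
        + θ ⟨i + 1, by omega⟩ ^ 2 = 0 :=
    fun i h => hrec (i + 1) (by omega) (by omega)
  have e0 := step 0 (by omega)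
  have hne : θ ⟨0, by omega⟩ ≠ θ ⟨0 + 1, by omega⟩ := fun h => by
    simpa using hinj h
  have h0 : θ ⟨0, by omega⟩ ≠ 0 := fun h => hne (by
    rw [h] at e0 ⊢
    exact (pow_eq_zero_iff two_ne_zero |>.mp (by linear_combination e0)).symm)
  have h1 : θ ⟨0 + 1, by omega⟩ ≠ 0 := fun h => hne (by
    rw [h] at e0 ⊢
    exact pow_eq_zero_iff two_ne_zero |>.mp (by linear_combination e0))
  obtain ⟨q, hq⟩ : ∃ q, θ ⟨0 + 1, by omega⟩ = q * θ ⟨0, by omega⟩ :=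
    ⟨_, (div_mul_cancel₀ _ h0).symm⟩
  have hq0 : q ≠ 0 := by
    rintro rfl
    exact h1 (by simpa using hq)
  have hβ : 1 - β * q + q ^ 2 = 0 := by
    rw [hq] at e0
    exact (mul_eq_zero_iff_left (pow_ne_zero 2 h0)).mp (by linear_combination e0)
  have geom : ∀ i : ℕ, ∀ h : i < d, θ ⟨i + 1, by omega⟩ = q * θ ⟨i, by omega⟩ := by
    intro i
    induction i with
    | zero => exact fun _ => hq
    | succ i ih =>
      intro h
      have hi := ih (by omega)
      have hdist : θ ⟨i + 1 + 1, by omega⟩ - θ ⟨i, by omega⟩ ≠ 0 :=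
        sub_ne_zero.mpr fun h' => by have := Fin.mk.inj (hinj h'); omega
      have hsum : θ ⟨i + 1 + 1, by omega⟩ + θ ⟨i, by omega⟩ - β * θ ⟨i + 1, by omega⟩ = 0 :=
        (mul_eq_zero_iff_left hdist).mp (by
          linear_combination step (i + 1) h - step i (by omega))
      linear_combination hsum + (β - q) * hi - θ ⟨i, by omega⟩ * hβ
  refine ⟨q, hq0, fun i h1 h2 => ?_, ?_⟩
  · obtain ⟨j, rfl⟩ := Nat.exists_eq_add_of_le' h1
    exact geom j (by omega)
  · field_simp
    linear_combination hβ
end
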